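/- Let χ be a real (quadratic) non-principal primitive Dirichlet character modulo q ≥ 3, and let β₁ and β₂ be real numbers with β₁ ≠ β₂ such that L(β₁,χ) = 0 and L(β₂,χ) = 0. Then min(β₁, β₂) ≤ 1 − 1/(1.0971 · log q). -/

import Mathlib

set_option autoImplicit false
open scoped Real
open Complex

/-- An entire function, not identically zero, can be divided by a power of `z - ρ` so that the
quotient is entire and does not vanish at `ρ`. -/
lemma exists_entire_quotient_at_point {f : ℂ → ℂ} (hf : Differentiable ℂ f) {z₀ : ℂ}
    (hz₀ : f z₀ ≠ 0) (ρ : ℂ) :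
    ∃ (n : ℕ) (g : ℂ → ℂ), Differentiable ℂ g ∧ g ρ ≠ 0 ∧ ∀ z, f z = (z - ρ) ^ n * g z := by
  have hne : analyticOrderAt f ρ ≠ ⊤ := by
    refine AnalyticOnNhd.analyticOrderAt_ne_top_of_isPreconnected (U := Set.univ) (x := z₀)
      (fun z _ ↦ hf.analyticAt z) isPreconnected_univ trivial trivial ?_
    rw [(hf.analyticAt z₀).analyticOrderAt_eq_zero.mpr hz₀]
    simp
  obtain ⟨n, hn⟩ := ENat.ne_top_iff_exists.mp hne
  clear hz₀ hne
  induction n generalizing f with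
  | zero =>
    refine ⟨0, f, hf, ?_, by simp⟩
    exact (hf.analyticAt ρ).analyticOrderAt_eq_zero.mp (by simpa using hn.symm)
  | succ n ih =>
    have h0 : f ρ = 0 := by
      by_contra h
      rw [(hf.analyticAt ρ).analyticOrderAt_eq_zero.mpr h] at hn
      simp at hn
    have hd : Differentiable ℂ (dslope f ρ) := by
      rw [← differentiableOn_univ, Complex.differentiableOn_dslope Filter.univ_mem]
      exact hf.differentiableOn
    have hmul : f = (fun z ↦ z - ρ) * dslope f ρ := by
      ext z
      have := sub_smul_dslope f ρ z
      simpa [h0] using this.symm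
    have hord : analyticOrderAt (fun z : ℂ ↦ z - ρ) ρ = 1 := by simp
    have hn' : (n : ℕ∞) = analyticOrderAt (dslope f ρ) ρ := by
      have h1 := analyticOrderAt_mul (f := fun z : ℂ ↦ z - ρ) (g := dslope f ρ) (z₀ := ρ)
        (by fun_prop) (hd.analyticAt ρ)
      rw [← hmul, hord, ← hn] at h1
      push_cast at h1
      rw [add_comm] at h1
      exact (ENat.add_right_injective_of_ne_top (by simp : (1 : ℕ∞) ≠ ⊤)) h1
    obtain ⟨m, g, hg, hgρ, hfac⟩ := ih hd hn'
    refine ⟨m + 1, g, hg, hgρ, fun z ↦ ?_⟩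
    rw [hmul, Pi.mul_apply, hfac z]
    ring

/-- The zeros of an entire function in a closed disc can be factored out. -/
lemma exists_factorization_closedBall {f : ℂ → ℂ} (hf : Differentiable ℂ f) {z₀ : ℂ}
    (hz₀ : f z₀ ≠ 0) (R : ℝ) :
    ∃ (M : Multiset ℂ) (g : ℂ → ℂ), Differentiable ℂ g ∧
      (∀ z ∈ Metric.closedBall (0 : ℂ) R, g z ≠ 0) ∧
      (∀ ρ ∈ M, ρ ∈ Metric.closedBall (0 : ℂ) R ∧ f ρ = 0) ∧
      ∀ z, f z = (M.map (fun ρ ↦ z - ρ)).prod * g z := by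
  have hfin : {z ∈ Metric.closedBall (0 : ℂ) R | f z = 0}.Finite := by
    have hcod := AnalyticOnNhd.preimage_zero_mem_codiscrete (f := f)
      (fun z _ ↦ hf.analyticAt z) (x := z₀) hz₀
    have := (isCompact_closedBall (0 : ℂ) R).finite_sdiff_of_mem_codiscreteWithin
      (s := f ⁻¹' {0}ᶜ) (Filter.codiscreteWithin_mono (Set.subset_univ _) hcod)
    refine this.subset fun z hz ↦ ⟨hz.1, by simpa using hz.2⟩
  suffices H : ∀ (S : Finset ℂ) (f : ℂ → ℂ), Differentiable ℂ f → f z₀ ≠ 0 →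
      (∀ z ∈ Metric.closedBall (0 : ℂ) R, f z = 0 → z ∈ S) →
      (∀ z ∈ S, z ∈ Metric.closedBall (0 : ℂ) R) →
      ∃ (M : Multiset ℂ) (g : ℂ → ℂ), Differentiable ℂ g ∧
        (∀ z ∈ Metric.closedBall (0 : ℂ) R, g z ≠ 0) ∧
        (∀ ρ ∈ M, ρ ∈ Metric.closedBall (0 : ℂ) R ∧ f ρ = 0) ∧
        ∀ z, f z = (M.map (fun ρ ↦ z - ρ)).prod * g z from
    H hfin.toFinset f hf hz₀ (by simp +contextual) (by simp +contextual)
  intro S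
  induction S using Finset.induction_on with
  | empty =>
    intro f hf _ hS _
    exact ⟨0, f, hf, fun z hz h ↦ by simpa using hS z hz h, by simp, by simp⟩
  | insert ρ S _ ih =>
    intro f hf hz₀ hS hSb
    obtain ⟨n, g, hg, hgρ, hfac⟩ := exists_entire_quotient_at_point hf hz₀ ρ
    obtain ⟨M, k, hk, hk0, hM, hprod⟩ := ih g hg
      (fun h ↦ hz₀ (by rw [hfac, h, mul_zero]))
      (fun z hz h ↦ by
        have := hS z hz (by rw [hfac, h, mul_zero])
        rcases Finset.mem_insert.mp this with rfl | h'
        · exact absurd h hgρ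
        · exact h')
      (fun z hz ↦ hSb z (Finset.mem_insert_of_mem hz))
    refine ⟨Multiset.replicate n ρ + M, k, hk, hk0, fun w hw ↦ ?_, fun z ↦ ?_⟩
    · rcases Multiset.mem_add.mp hw with h | h
      · obtain ⟨hn, rfl⟩ := Multiset.mem_replicate.mp h
        exact ⟨hSb _ (Finset.mem_insert_self _ _), by rw [hfac, sub_self, zero_pow hn, zero_mul]⟩
      · exact ⟨(hM w h).1, by rw [hfac, (hM w h).2, mul_zero]⟩
    · rw [hfac, hprod z]
      simp [mul_assoc]

/-- A zero-free holomorphic function on a disc has a holomorphic logarithm there, normalised to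
vanish at the centre. -/
lemma exists_holomorphic_log_ball {g : ℂ → ℂ} {c : ℂ} {r : ℝ}
    (hg : DifferentiableOn ℂ g (Metric.ball c r)) (h0 : ∀ z ∈ Metric.ball c r, g z ≠ 0)
    (hr : 0 < r) :
    ∃ h : ℂ → ℂ, h c = 0 ∧ (∀ z ∈ Metric.ball c r, HasDerivAt h (logDeriv g z) z) ∧
      ∀ z ∈ Metric.ball c r, g z = g c * exp (h z) := by
  have hd : DifferentiableOn ℂ (logDeriv g) (Metric.ball c r) :=
    (hg.deriv Metric.isOpen_ball).div hg h0
  obtain ⟨k, hk⟩ := hd.isExactOn_ball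
  have hc : c ∈ Metric.ball c r := Metric.mem_ball_self hr
  refine ⟨fun z ↦ k z - k c, by simp, fun z hz ↦ (hk z hz).sub_const _, fun z hz ↦ ?_⟩
  have hq : ∀ w ∈ Metric.ball c r, HasDerivAt (fun w ↦ g w * exp (-(k w - k c))) 0 w := by
    intro w hw
    have h1 := (hg.differentiableAt (Metric.isOpen_ball.mem_nhds hw)).hasDerivAt
    have h2 : HasDerivAt (fun w ↦ exp (-(k w - k c))) (exp (-(k w - k c)) * -logDeriv g w) w :=
      (((hk w hw).sub_const (k c)).neg).cexp
    refine (h1.mul h2).congr_deriv ?_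
    rw [logDeriv_apply]
    field_simp [h0 w hw]
    ring
  have hconst : g z * exp (-(k z - k c)) = g c * exp (-(k c - k c)) := by
    refine IsOpen.is_const_of_deriv_eq_zero (s := Metric.ball c r)
      (f := fun w ↦ g w * exp (-(k w - k c))) Metric.isOpen_ball
      (convex_ball c r).isPreconnected
      (fun w hw ↦ (hq w hw).differentiableAt.differentiableWithinAt)
      (fun w hw ↦ (hq w hw).deriv) hz hc
  rw [sub_self, neg_zero, exp_zero, mul_one, exp_neg] at hconst
  rw [← hconst]
  field_simp

/-- If `g` is zero-free on a large disc and not much larger there than at `z₀`, then its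
logarithmic derivative is almost constant near the origin. -/
lemma norm_logDeriv_sub_logDeriv_le {g : ℂ → ℂ} {z₀ : ℂ} {R A B : ℝ} (hg : Differentiable ℂ g)
    (h0 : ∀ z ∈ Metric.closedBall (0 : ℂ) R, g z ≠ 0) (hA : 0 < A)
    (hbd : ∀ z ∈ Metric.closedBall (0 : ℂ) R, ‖g z‖ ≤ Real.exp A * ‖g z₀‖)
    (hB : 0 ≤ B) (hR : 16 * (B + ‖z₀‖) < R) {z w : ℂ} (hz : ‖z‖ ≤ B) (hw : ‖w‖ ≤ B) :
    ‖logDeriv g z - logDeriv g w‖ ≤ 256 * A / R ^ 2 * ‖z - w‖ := by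
  have hz₀ := norm_nonneg z₀
  have hR0 : 0 < R := by linarith
  have hsub : Metric.ball z₀ (R / 2) ⊆ Metric.closedBall 0 R := by
    refine Metric.ball_subset_closedBall.trans (Metric.closedBall_subset_closedBall' ?_)
    rw [dist_zero_right]; linarith
  have hgz₀ : g z₀ ≠ 0 := h0 z₀ (hsub (Metric.mem_ball_self (by linarith)))
  obtain ⟨h, hh0, hder, hexp⟩ := exists_holomorphic_log_ball (c := z₀) (r := R / 2)
    hg.differentiableOn (fun z hz ↦ h0 z (hsub hz)) (by linarith)
  have hre : ∀ z ∈ Metric.ball z₀ (R / 2), (h z).re ≤ A := by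
    intro z hz
    have h1 := hbd z (hsub hz)
    rw [hexp z hz, norm_mul, norm_exp, mul_comm] at h1
    exact Real.exp_le_exp.mp (le_of_mul_le_mul_right h1 (norm_pos_iff.mpr hgz₀))
  have hbound : ∀ z ∈ Metric.closedBall z₀ (R / 4), ‖h z‖ ≤ 2 * A := by
    intro z hz
    rw [mem_closedBall_iff_norm] at hz
    have key := borelCaratheodory_zero (f := fun w ↦ h (z₀ + w)) (M := A) (R := R / 2)
      (z := z - z₀) hA ?_ ?_ (by linarith) (by rw [mem_ball_zero_iff]; linarith) (by simpa)
    · simp only [add_sub_cancel] at key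
      refine key.trans ?_
      rw [div_le_iff₀ (by linarith)]
      nlinarith
    · intro w hw
      have : z₀ + w ∈ Metric.ball z₀ (R / 2) := by simpa [mem_ball_iff_norm] using hw
      exact ((hder _ this).comp_const_add z₀ w).differentiableAt.differentiableWithinAt
    · intro w hw
      exact hre _ (by simpa [mem_ball_iff_norm] using hw)
  have hk : ∀ z ∈ Metric.closedBall z₀ (R / 8), ‖logDeriv g z‖ ≤ 2 * A / (R / 8) := by
    intro z hz
    have hin : Metric.closedBall z (R / 8) ⊆ Metric.closedBall z₀ (R / 4) := by
      refine Metric.closedBall_subset_closedBall' ?_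
      rw [Metric.mem_closedBall] at hz; linarith
    have hin2 : Metric.closedBall z₀ (R / 4) ⊆ Metric.ball z₀ (R / 2) :=
      Metric.closedBall_subset_ball (by linarith)
    have hmem : z ∈ Metric.ball z₀ (R / 2) :=
      hin2 (hin (Metric.mem_closedBall_self (by linarith)))
    rw [← (hder z hmem).deriv]
    refine norm_deriv_le_of_forall_mem_sphere_norm_le (by linarith) ?_
      fun w hw ↦ hbound w (hin (Metric.sphere_subset_closedBall hw))
    refine DifferentiableOn.diffContOnCl fun w hw ↦ ?_
    have := hin2 (hin (Metric.closure_ball_subset_closedBall hw))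
    exact (hder w this).differentiableAt.differentiableWithinAt
  have hdiff : ∀ z ∈ Metric.closedBall (0 : ℂ) R, DifferentiableAt ℂ (logDeriv g) z := fun z hz ↦
    ((hg.analyticAt z).deriv.differentiableAt).div (hg z) (h0 z hz)
  have hin3 : Metric.closedBall z₀ (R / 8) ⊆ Metric.closedBall 0 R :=
    (Metric.closedBall_subset_ball (by linarith)).trans hsub
  have hk' : ∀ z ∈ Metric.closedBall (0 : ℂ) B, ‖deriv (logDeriv g) z‖ ≤ 256 * A / R ^ 2 := by
    intro z hz
    have hin : Metric.closedBall z (R / 16) ⊆ Metric.closedBall z₀ (R / 8) := by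
      refine Metric.closedBall_subset_closedBall' ?_
      have := norm_sub_le z z₀
      rw [mem_closedBall_zero_iff] at hz
      rw [dist_eq_norm]; linarith
    have := norm_deriv_le_of_forall_mem_sphere_norm_le (f := logDeriv g) (c := z) (R := R / 16)
      (by linarith) ?_ fun w hw ↦ hk w (hin (Metric.sphere_subset_closedBall hw))
    · refine this.trans_eq ?_
      field_simp
      norm_num
    · refine DifferentiableOn.diffContOnCl fun w hw ↦ ?_
      have := hin3 (hin (Metric.closure_ball_subset_closedBall hw))
      exact (hdiff w this).differentiableWithinAt
  refine Convex.norm_image_sub_le_of_norm_deriv_le (s := Metric.closedBall (0 : ℂ) B)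
    (fun x hx ↦ hdiff x (Metric.closedBall_subset_closedBall (by linarith) hx)) hk'
    (convex_closedBall _ _) (by simpa using hw) (by simpa using hz)

lemma differentiable_multiset_prod_sub (M : Multiset ℂ) :
    Differentiable ℂ (fun z ↦ (M.map (fun ρ ↦ z - ρ)).prod) := by
  induction M using Multiset.induction_on with
  | empty => simp
  | cons ρ M ih =>
    simp only [Multiset.map_cons, Multiset.prod_cons]
    fun_prop

lemma logDeriv_multiset_prod_sub (M : Multiset ℂ) {z : ℂ} (hz : z ∉ M) :
    logDeriv (fun z ↦ (M.map (fun ρ ↦ z - ρ)).prod) z = (M.map (fun ρ ↦ 1 / (z - ρ))).sum := by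
  induction M using Multiset.induction_on with
  | empty => simp
  | cons ρ M ih =>
    simp only [Multiset.mem_cons, not_or] at hz
    simp only [Multiset.map_cons, Multiset.prod_cons, Multiset.sum_cons]
    rw [logDeriv_mul, ih hz.2]
    · congr 1
      rw [logDeriv_apply]; simp
    · exact sub_ne_zero.mpr hz.1
    · simp only [ne_eq, Multiset.prod_eq_zero_iff, Multiset.mem_map, not_exists, not_and]
      rintro x hx h
      exact hz.2 (sub_eq_zero.mp h ▸ hx)
    · fun_prop
    · exact differentiable_multiset_prod_sub M z

lemma logDeriv_neg_of_symm {f : ℂ → ℂ} {c : ℂ} (hsymm : ∀ z, f (-z) = c * f z) (hc : c ≠ 0) (z : ℂ) :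
    logDeriv f (-z) = -logDeriv f z := by
  have h1 : deriv (fun z ↦ f (-z)) z = c * deriv f z := by
    simp only [hsymm]
    exact deriv_const_mul_field c
  rw [deriv_comp_neg] at h1
  rw [logDeriv_apply, logDeriv_apply, hsymm, neg_eq_iff_eq_neg.mp h1, neg_div,
    mul_div_mul_left _ _ hc]

theorem exists_multiset_logDeriv_approx {f : ℂ → ℂ} (hf : Differentiable ℂ f) {c : ℂ}
    (hsymm : ∀ z, f (-z) = c * f z) {z₀ : ℂ} (hz₀ : f z₀ ≠ 0)
    (hgrowth : ∀ ε > 0, ∃ R₀, ∀ z, R₀ ≤ ‖z‖ → ‖f z‖ ≤ Real.exp (ε * ‖z‖ ^ 2))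
    {B δ : ℝ} (hB : 0 ≤ B) (hδ : 0 < δ) :
    ∃ M : Multiset ℂ, (∀ ρ ∈ M, f ρ = 0) ∧ (∀ ρ, f ρ = 0 → ‖ρ‖ ≤ B → ρ ∈ M) ∧
      ∀ z, ‖z‖ ≤ B → f z ≠ 0 →
        ‖logDeriv f z - 1 / 2 * (M.map (fun ρ ↦ 1 / (z - ρ) + 1 / (z + ρ))).sum‖ ≤ δ := by
  have hc : c ≠ 0 := by
    rintro rfl
    exact hz₀ (by simpa using hsymm (-z₀))
  set ε : ℝ := δ / (2560 * (B + 1)) with hε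
  have hε0 : 0 < ε := by positivity
  obtain ⟨R₀, hR₀⟩ := hgrowth ε hε0
  set L : ℝ := |Real.log ‖f z₀‖| with hL
  obtain ⟨R, hR1, hR2, hR3, hR4⟩ : ∃ R : ℝ, 1 ≤ R ∧ R₀ ≤ R ∧ 16 * (B + ‖z₀‖) < R ∧ L ≤ ε * R ^ 2 := by
    have h1 : Filter.Tendsto (fun R : ℝ ↦ ε * R ^ 2) Filter.atTop Filter.atTop :=
      (Filter.tendsto_pow_atTop (by norm_num)).const_mul_atTop hε0
    exact ((Filter.eventually_ge_atTop 1).and ((Filter.eventually_ge_atTop R₀).and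
      ((Filter.eventually_gt_atTop _).and (h1.eventually_ge_atTop L)))).exists
  have hz₀' := norm_nonneg z₀
  obtain ⟨M, g, hg, hg0, hM, hfac⟩ := exists_factorization_closedBall hf hz₀ R
  have hgz₀ : g z₀ ≠ 0 := fun h ↦ hz₀ (by rw [hfac, h, mul_zero])
  have hsphere : ∀ z ∈ Metric.sphere (0 : ℂ) (3 * R),
      ‖g z‖ ≤ Real.exp (10 * ε * R ^ 2) * ‖g z₀‖ := by
    intro z hz
    rw [mem_sphere_zero_iff_norm] at hz
    have h1 : ∀ N : Multiset ℂ, (∀ ρ ∈ N, ρ ∈ M) →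
        ‖(N.map (fun ρ ↦ z₀ - ρ)).prod‖ ≤ ‖(N.map (fun ρ ↦ z - ρ)).prod‖ := by
      intro N
      induction N using Multiset.induction_on with
      | empty => simp
      | cons ρ N ih =>
        intro hN
        simp only [Multiset.map_cons, Multiset.prod_cons, norm_mul]
        refine mul_le_mul ?_ (ih fun x hx ↦ hN x (Multiset.mem_cons_of_mem hx)) (norm_nonneg _)
          (norm_nonneg _)
        have h2 : ‖ρ‖ ≤ R := by simpa using (hM ρ (hN ρ (Multiset.mem_cons_self _ _))).1
        have h3 := norm_sub_le z₀ ρ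
        have h4 := norm_sub_norm_le z ρ
        linarith
    have h2 := h1 M fun _ h ↦ h
    have h3 := hR₀ z (by rw [hz]; linarith)
    have h4 : ‖g z‖ * ‖f z₀‖ ≤ ‖f z‖ * ‖g z₀‖ := by
      rw [hfac z, hfac z₀, norm_mul, norm_mul]
      nlinarith [mul_le_mul_of_nonneg_right h2 (mul_nonneg (norm_nonneg (g z)) (norm_nonneg (g z₀)))]
    have h5 : Real.exp (-(ε * R ^ 2)) ≤ ‖f z₀‖ := by
      rw [← Real.le_log_iff_exp_le (norm_pos_iff.mpr hz₀)]
      have := neg_abs_le (Real.log ‖f z₀‖)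
      linarith
    rw [hz] at h3
    have h6 : Real.exp (10 * ε * R ^ 2) * Real.exp (-(ε * R ^ 2)) = Real.exp (ε * (3 * R) ^ 2) := by
      rw [← Real.exp_add]; congr 1; ring
    have h7 : ‖g z‖ * Real.exp (-(ε * R ^ 2)) ≤
        (Real.exp (10 * ε * R ^ 2) * ‖g z₀‖) * Real.exp (-(ε * R ^ 2)) := by
      calc _ ≤ ‖g z‖ * ‖f z₀‖ := by gcongr
        _ ≤ ‖f z‖ * ‖g z₀‖ := h4
        _ ≤ Real.exp (ε * (3 * R) ^ 2) * ‖g z₀‖ := by gcongr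
        _ = _ := by rw [← h6]; ring
    exact le_of_mul_le_mul_right h7 (Real.exp_pos _)
  have hbd : ∀ z ∈ Metric.closedBall (0 : ℂ) R, ‖g z‖ ≤ Real.exp (10 * ε * R ^ 2) * ‖g z₀‖ := by
    intro z hz
    refine norm_le_of_forall_mem_frontier_norm_le (U := Metric.ball (0 : ℂ) (3 * R))
      Metric.isBounded_ball hg.diffContOnCl (fun w hw ↦ hsphere w ?_) ?_
    · rwa [frontier_ball _ (by positivity)] at hw
    · rw [closure_ball _ (by positivity)]
      exact Metric.closedBall_subset_closedBall (by linarith) hz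
  refine ⟨M, fun ρ hρ ↦ (hM ρ hρ).2, fun ρ hρ hρB ↦ ?_, fun z hzB hfz ↦ ?_⟩
  · by_contra hρM
    have hne : (M.map (fun ρ' ↦ ρ - ρ')).prod ≠ 0 := by
      simp only [ne_eq, Multiset.prod_eq_zero_iff, Multiset.mem_map, not_exists, not_and]
      rintro x hx h
      exact hρM (sub_eq_zero.mp h ▸ hx)
    rw [hfac] at hρ
    refine hg0 ρ ?_ ((mul_eq_zero.mp hρ).resolve_left hne)
    rw [mem_closedBall_zero_iff]; linarith
  have hformula : ∀ w, ‖w‖ ≤ B → f w ≠ 0 →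
      logDeriv f w = (M.map (fun ρ ↦ 1 / (w - ρ))).sum + logDeriv g w := by
    intro w hw hfw
    have hwM : w ∉ M := fun h ↦ hfw (hM w h).2
    have hff : f = fun z ↦ (M.map (fun ρ ↦ z - ρ)).prod * g z := funext hfac
    rw [← logDeriv_multiset_prod_sub M hwM, ← logDeriv_mul, ← hff]
    · exact fun h ↦ hfw (by rw [hfac, h, zero_mul])
    · exact fun h ↦ hfw (by rw [hfac, h, mul_zero])
    · exact differentiable_multiset_prod_sub M w
    · exact hg w
  have hneg := logDeriv_neg_of_symm hsymm hc z
  have hfnz : f (-z) ≠ 0 := by rw [hsymm]; exact mul_ne_zero hc hfz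
  rw [hformula (-z) (by rwa [norm_neg]) hfnz] at hneg
  have hsum : (M.map (fun ρ ↦ 1 / (z - ρ) + 1 / (z + ρ))).sum =
      (M.map (fun ρ ↦ 1 / (z - ρ))).sum - (M.map (fun ρ ↦ 1 / (-z - ρ))).sum := by
    rw [← Multiset.sum_map_sub]
    congr 1
    refine Multiset.map_congr rfl fun ρ _ ↦ ?_
    rw [show -z - ρ = -(z + ρ) by ring, div_neg, sub_neg_eq_add]
  have hdiff := norm_logDeriv_sub_logDeriv_le hg hg0 (by positivity) hbd hB hR3 hzB
    (w := -z) (by rwa [norm_neg])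
  have heq : logDeriv f z - 1 / 2 * (M.map (fun ρ ↦ 1 / (z - ρ) + 1 / (z + ρ))).sum =
      1 / 2 * (logDeriv g z - logDeriv g (-z)) := by
    rw [hsum]
    linear_combination (1 / 2 : ℂ) * hformula z hzB hfz + (1 / 2 : ℂ) * hneg
  rw [heq, norm_mul]
  have h2 : ‖z - -z‖ ≤ 2 * B := by
    rw [show z - -z = 2 * z by ring, norm_mul]; simpa using hzB
  have h3 : 256 * (10 * ε * R ^ 2) / R ^ 2 = 2560 * ε := by field_simp; norm_num
  rw [h3] at hdiff
  have h4 : ε * (2560 * (B + 1)) = δ := by rw [hε]; field_simp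
  have : ‖(1 / 2 : ℂ)‖ = 1 / 2 := by simp
  rw [this]
  nlinarith

/-- The Mellin transform `Λ₀` attached to a weak functional-equation pair is bounded on vertical
strips. -/
lemma WeakFEPair.exists_norm_Λ₀_le {E : Type*} [NormedAddCommGroup E] [NormedSpace ℂ E]
    (P : WeakFEPair E) (a b : ℝ) :
    ∃ C : ℝ, ∀ s : ℂ, a ≤ s.re → s.re ≤ b → ‖P.Λ₀ s‖ ≤ C := by
  have hconv : ∀ s : ℂ, MellinConvergent P.f_modif s := fun s ↦
    (P.isStrongFEPair_toStrongFEPair.hasMellin s).1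
  have hnorm : ∀ x : ℝ, MeasureTheory.IntegrableOn (fun t : ℝ ↦ t ^ (x - 1) * ‖P.f_modif t‖)
      (Set.Ioi 0) := by
    intro x
    refine MeasureTheory.IntegrableOn.congr_fun (hconv x).norm (fun t ht ↦ ?_) measurableSet_Ioi
    simp only [norm_smul]
    rw [norm_cpow_eq_rpow_re_of_pos ht]
    simp
  refine ⟨∫ t in Set.Ioi (0 : ℝ), (t ^ (a - 1) * ‖P.f_modif t‖ + t ^ (b - 1) * ‖P.f_modif t‖),
    fun s hsa hsb ↦ ?_⟩
  refine MeasureTheory.norm_integral_le_of_norm_le ((hnorm a).add (hnorm b)) ?_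
  refine (MeasureTheory.ae_restrict_mem measurableSet_Ioi).mono fun t (ht : 0 < t) ↦ ?_
  rw [norm_smul, norm_cpow_eq_rpow_re_of_pos ht, ← add_mul, sub_re, one_re]
  refine mul_le_mul_of_nonneg_right ?_ (norm_nonneg _)
  have h1 := Real.rpow_nonneg ht.le (a - 1)
  have h2 := Real.rpow_nonneg ht.le (b - 1)
  rcases le_total t 1 with h | h
  · have := Real.rpow_le_rpow_of_exponent_ge ht h (sub_le_sub_right hsa 1)
    linarith
  · have := Real.rpow_le_rpow_of_exponent_le h (sub_le_sub_right hsb 1)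
    linarith

lemma exists_norm_completedHurwitzZetaEven₀_le (x : UnitAddCircle) (a b : ℝ) :
    ∃ C : ℝ, ∀ s : ℂ, a ≤ s.re → s.re ≤ b → ‖HurwitzZeta.completedHurwitzZetaEven₀ x s‖ ≤ C := by
  obtain ⟨C, hC⟩ := (HurwitzZeta.hurwitzEvenFEPair x).exists_norm_Λ₀_le (a / 2) (b / 2)
  refine ⟨C / 2, fun s h1 h2 ↦ ?_⟩
  rw [HurwitzZeta.completedHurwitzZetaEven₀, norm_div]
  have := hC (s / 2) (by simp; linarith) (by simp; linarith)
  simp only [norm_ofNat]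
  linarith

lemma exists_norm_completedHurwitzZetaOdd_le (x : UnitAddCircle) (a b : ℝ) :
    ∃ C : ℝ, ∀ s : ℂ, a ≤ s.re → s.re ≤ b → ‖HurwitzZeta.completedHurwitzZetaOdd x s‖ ≤ C := by
  have hS := HurwitzZeta.isStrong_hurwitzOddFEPair x
  obtain ⟨C, hC⟩ := (HurwitzZeta.hurwitzOddFEPair x).exists_norm_Λ₀_le ((a + 1) / 2) ((b + 1) / 2)
  refine ⟨C / 2, fun s h1 h2 ↦ ?_⟩
  rw [HurwitzZeta.completedHurwitzZetaOdd, norm_div]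
  have := hC ((s + 1) / 2) (by simp; linarith) (by simp; linarith)
  rw [WeakFEPair.Λ₀_eq, hS.hf₀, hS.hg₀, smul_zero, smul_zero, add_zero, add_zero] at this
  simp only [norm_ofNat]
  linarith

lemma DirichletCharacter.exists_norm_completedLFunction_le {N : ℕ} [NeZero N]
    {χ : DirichletCharacter ℂ N} (hχ : χ ≠ 1) (a b : ℝ) :
    ∃ C : ℝ, ∀ s : ℂ, a ≤ s.re → s.re ≤ b → ‖completedLFunction χ s‖ ≤ C := by
  choose Ce hCe using fun j : ZMod N ↦
    exists_norm_completedHurwitzZetaEven₀_le (ZMod.toAddCircle j) a b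
  choose Co hCo using fun j : ZMod N ↦
    exists_norm_completedHurwitzZetaOdd_le (ZMod.toAddCircle j) a b
  have hN : N ≠ 1 := fun h ↦ hχ (by subst h; exact level_one χ)
  refine ⟨(N : ℝ) ^ (-a) * ∑ j, ‖χ j‖ * Ce j + (N : ℝ) ^ (-a) * ∑ j, ‖χ j‖ * Co j,
    fun s h1 h2 ↦ ?_⟩
  have hNs : ‖(N : ℂ) ^ (-s)‖ ≤ (N : ℝ) ^ (-a) := by
    rw [norm_natCast_cpow_of_pos (NeZero.pos N)]
    exact Real.rpow_le_rpow_of_exponent_le (by exact_mod_cast NeZero.one_le) (by simpa using h1)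
  rw [completedLFunction, ZMod.completedLFunction_eq, χ.map_zero' hN, χ.sum_eq_zero_of_ne_one hχ,
    mul_zero, zero_div, zero_div, sub_zero, sub_zero, ZMod.completedLFunction₀]
  refine (norm_add_le _ _).trans (add_le_add ?_ ?_)
  · rw [norm_mul]
    refine mul_le_mul hNs ((norm_sum_le _ _).trans (Finset.sum_le_sum fun j _ ↦ ?_))
      (norm_nonneg _) (by positivity)
    rw [norm_mul]
    exact mul_le_mul_of_nonneg_left (hCe j s h1 h2) (norm_nonneg _)
  · rw [norm_mul]
    refine mul_le_mul hNs ((norm_sum_le _ _).trans (Finset.sum_le_sum fun j _ ↦ ?_))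
      (norm_nonneg _) (by positivity)
    rw [norm_mul]
    exact mul_le_mul_of_nonneg_left (hCo j s h1 h2) (norm_nonneg _)

lemma norm_Gamma_le_of_re_le {s : ℂ} {x : ℝ} (hs : 1 ≤ s.re) (hx : s.re + 1 ≤ x) :
    ‖Gamma s‖ ≤ Real.exp (x * Real.log x) := by
  have hx2 : 2 ≤ x := by linarith
  have h1 : ‖Gamma s‖ ≤ Real.Gamma s.re := by
    rw [Gamma_eq_integral (by linarith), Real.Gamma_eq_integral (by linarith), GammaIntegral]
    refine (MeasureTheory.norm_integral_le_integral_norm _).trans_eq ?_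
    refine MeasureTheory.setIntegral_congr_fun measurableSet_Ioi fun t ht ↦ ?_
    simp only [norm_mul]
    rw [norm_cpow_eq_rpow_re_of_pos ht, norm_real, Real.norm_of_nonneg (Real.exp_pos _).le]
    simp
  have h2 : Real.Gamma s.re ≤ Real.Gamma (s.re + 1) := by
    rw [Real.Gamma_add_one (by linarith)]
    exact le_mul_of_one_le_left (Real.Gamma_pos_of_pos (by linarith)).le hs
  have h3 : Real.Gamma (s.re + 1) ≤ Real.Gamma (⌊x⌋₊ + 1) :=
    Real.Gamma_strictMonoOn_Ici.monotoneOn (by simp; linarith)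
      (by
        have : 1 ≤ ⌊x⌋₊ := Nat.le_floor (by simp; linarith)
        have : (1 : ℝ) ≤ ⌊x⌋₊ := by exact_mod_cast this
        simp; linarith)
      (hx.trans (Nat.lt_floor_add_one x).le)
  rw [Real.Gamma_nat_eq_factorial] at h3
  have h4 : ((⌊x⌋₊).factorial : ℝ) ≤ (⌊x⌋₊ : ℝ) ^ ⌊x⌋₊ := by exact_mod_cast Nat.factorial_le_pow _
  have h5 : (⌊x⌋₊ : ℝ) ^ ⌊x⌋₊ ≤ x ^ ⌊x⌋₊ := by
    gcongr
    exact Nat.floor_le (by linarith)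
  have h6 : x ^ ⌊x⌋₊ ≤ x ^ x := by
    rw [← Real.rpow_natCast]
    exact Real.rpow_le_rpow_of_exponent_le (by linarith) (Nat.floor_le (by linarith))
  rw [Real.rpow_def_of_pos (by linarith), mul_comm] at h6
  linarith

lemma DirichletCharacter.inv_eq_self_of_real {q : ℕ} {χ : DirichletCharacter ℂ q}
    (hreal : ∀ n : ZMod q, (χ n).im = 0) : χ⁻¹ = χ := by
  rw [← MulChar.star_eq_inv]
  ext n
  rw [MulChar.star_apply]
  exact conj_eq_iff_im.mpr (hreal n)

/-- The completed `L`-function of `ζ(s) L(s, χ)`, made entire by the factor `s (1 - s)` and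
normalised by the conductor so that its functional equation is `s ↦ 1 - s` up to a constant. -/
noncomputable def DirichletCharacter.xiProduct {q : ℕ} [NeZero q] (χ : DirichletCharacter ℂ q)
    (s : ℂ) : ℂ :=
  (s * (1 - s) * completedRiemannZeta₀ s - 1) * (q : ℂ) ^ (s / 2) * completedLFunction χ s

namespace DirichletCharacter

variable {q : ℕ} [NeZero q] {χ : DirichletCharacter ℂ q}

lemma differentiable_xiProduct (hχ : χ ≠ 1) : Differentiable ℂ χ.xiProduct := by
  have h1 := differentiable_completedZeta₀
  have h2 := differentiable_completedLFunction hχ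
  have h3 : Differentiable ℂ (fun s : ℂ ↦ (q : ℂ) ^ (s / 2)) := by
    have := NeZero.ne q
    fun_prop (disch := simp [this])
  unfold xiProduct
  fun_prop

lemma xiProduct_one_sub (hprim : χ.IsPrimitive) (hinv : χ⁻¹ = χ) (s : ℂ) :
    χ.xiProduct (1 - s) = rootNumber χ * χ.xiProduct s := by
  have hq : (q : ℂ) ≠ 0 := NeZero.ne _
  have hpow : (q : ℂ) ^ ((1 - s) / 2) * (q : ℂ) ^ (s - 1 / 2) = (q : ℂ) ^ (s / 2) := by
    rw [← cpow_add _ _ hq]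
    congr 1
    ring
  rw [xiProduct, xiProduct, completedRiemannZeta₀_one_sub, hprim.completedLFunction_one_sub, hinv,
    ← hpow]
  ring

lemma completedLFunction_eq_mul (χ : DirichletCharacter ℂ q) {s : ℂ} (hs : 0 < s.re) :
    completedLFunction χ s = gammaFactor χ s * LFunction χ s := by
  have hs0 : s ≠ 0 := by rintro rfl; simp at hs
  have hγ : gammaFactor χ s ≠ 0 := by
    rcases χ.even_or_odd with h | h <;> rw [h.gammaFactor_def]
    · exact Gammaℝ_ne_zero_of_re_pos hs
    · exact Gammaℝ_ne_zero_of_re_pos (by simp; linarith)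
  rw [LFunction_eq_completed_div_gammaFactor χ s (.inl hs0), mul_div_cancel₀ _ hγ]

lemma xiProduct_eq (χ : DirichletCharacter ℂ q) {s : ℂ} (hs : 1 < s.re) :
    χ.xiProduct s = s * (1 - s) * Gammaℝ s * riemannZeta s * (q : ℂ) ^ (s / 2) *
      gammaFactor χ s * LFunction χ s := by
  have hs0 : s ≠ 0 := by rintro rfl; norm_num at hs
  have hs1 : 1 - s ≠ 0 := by rw [sub_ne_zero]; rintro rfl; norm_num at hs
  have hΓ : Gammaℝ s ≠ 0 := Gammaℝ_ne_zero_of_re_pos (by linarith)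
  have hz : completedRiemannZeta₀ s = Gammaℝ s * riemannZeta s + 1 / s + 1 / (1 - s) := by
    rw [riemannZeta_def_of_ne_zero hs0, mul_div_cancel₀ _ hΓ, completedRiemannZeta_eq]
    ring
  rw [xiProduct, completedLFunction_eq_mul χ (by linarith), hz]
  field_simp
  ring

lemma xiProduct_ne_zero (χ : DirichletCharacter ℂ q) {s : ℂ} (hs : 1 < s.re) :
    χ.xiProduct s ≠ 0 := by
  have hs0 : s ≠ 0 := by rintro rfl; norm_num at hs
  have hs1 : s ≠ 1 := by rintro rfl; norm_num at hs
  have hq : (q : ℂ) ≠ 0 := NeZero.ne _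
  rw [xiProduct_eq χ hs]
  have hγ : gammaFactor χ s ≠ 0 := by
    rcases χ.even_or_odd with h | h <;> rw [h.gammaFactor_def]
    · exact Gammaℝ_ne_zero_of_re_pos (by linarith)
    · exact Gammaℝ_ne_zero_of_re_pos (by simp; linarith)
  have := LFunction_ne_zero_of_one_le_re χ (.inr hs1) hs.le
  have := riemannZeta_ne_zero_of_one_le_re hs.le
  have := Gammaℝ_ne_zero_of_re_pos (s := s) (by linarith)
  have := sub_ne_zero.mpr hs1.symm
  simp [*]

lemma xiProduct_eq_zero_of_LFunction_eq_zero {s : ℂ} (hs : 0 < s.re) (h : LFunction χ s = 0) :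
    χ.xiProduct s = 0 := by
  rw [xiProduct, completedLFunction_eq_mul χ hs, h, mul_zero, mul_zero]

lemma re_mem_Icc_of_xiProduct_eq_zero (hprim : χ.IsPrimitive) (hinv : χ⁻¹ = χ) {s : ℂ}
    (h : χ.xiProduct s = 0) : 0 ≤ s.re ∧ s.re ≤ 1 := by
  constructor
  · by_contra! hs
    have h1 := xiProduct_one_sub hprim hinv s
    rw [h, mul_zero] at h1
    exact xiProduct_ne_zero χ (by simp; linarith) h1
  · by_contra! hs
    exact xiProduct_ne_zero χ hs h

end DirichletCharacter

lemma LSeries.exists_norm_le {f : ℕ → ℂ} {x : ℝ} (hf : LSeriesSummable f x) :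
    ∃ C : ℝ, ∀ s : ℂ, x ≤ s.re → ‖LSeries f s‖ ≤ C := by
  refine ⟨∑' n, ‖LSeries.term f x n‖, fun s hs ↦ ?_⟩
  have hle : ∀ n, ‖LSeries.term f s n‖ ≤ ‖LSeries.term f x n‖ :=
    LSeries.norm_term_le_of_re_le_re f (by simpa using hs)
  exact tsum_of_norm_bounded hf.norm.hasSum hle

lemma norm_Gammaℝ_le {s : ℂ} {x : ℝ} (hs : 2 ≤ s.re) (hx : s.re / 2 + 1 ≤ x) :
    ‖Gammaℝ s‖ ≤ Real.exp (x * Real.log x) := by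
  rw [Gammaℝ_def, norm_mul, norm_cpow_eq_rpow_re_of_pos Real.pi_pos]
  have h1 : π ^ (-s / 2).re ≤ 1 := by
    refine Real.rpow_le_one_of_one_le_of_nonpos (by linarith [Real.pi_gt_three]) ?_
    simp; linarith
  have h2 : ‖Gamma (s / 2)‖ ≤ Real.exp (x * Real.log x) :=
    norm_Gamma_le_of_re_le (by simp; linarith) (by simpa using hx)
  calc _ ≤ 1 * Real.exp (x * Real.log x) := by gcongr
    _ = _ := one_mul _

namespace DirichletCharacter

variable {q : ℕ} [NeZero q] {χ : DirichletCharacter ℂ q}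

lemma exists_norm_xiProduct_le (hχ : χ ≠ 1) :
    ∃ C K : ℝ, 0 ≤ C ∧ 0 ≤ K ∧ ∀ s : ℂ, 1 / 2 ≤ s.re → ‖χ.xiProduct s‖ ≤
      C * Real.exp (K * ‖s‖ + 4 * ((‖s‖ + 2) * Real.log (‖s‖ + 2))) := by
  obtain ⟨C₁, hC₁⟩ := exists_norm_completedHurwitzZetaEven₀_le 0 (1 / 2) 2
  obtain ⟨C₂, hC₂⟩ := exists_norm_completedLFunction_le hχ (1 / 2) 2
  obtain ⟨C₃, hC₃⟩ := LSeries.exists_norm_le (f := 1) (x := 2)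
    (LSeriesSummable_one_iff.mpr (by norm_num))
  obtain ⟨C₄, hC₄⟩ := LSeries.exists_norm_le (f := fun n ↦ χ n) (x := 2)
    (LSeriesSummable_of_one_lt_re χ (by norm_num))
  have hC₁0 : 0 ≤ C₁ := (norm_nonneg _).trans (hC₁ 1 (by norm_num) (by norm_num))
  have hC₂0 : 0 ≤ C₂ := (norm_nonneg _).trans (hC₂ 1 (by norm_num) (by norm_num))
  have hC₃0 : 0 ≤ C₃ := (norm_nonneg _).trans (hC₃ 2 (by norm_num))
  have hC₄0 : 0 ≤ C₄ := (norm_nonneg _).trans (hC₄ 2 (by norm_num))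
  have hq1 : (1 : ℝ) ≤ q := by exact_mod_cast NeZero.one_le
  have hlq : 0 ≤ Real.log q := Real.log_nonneg hq1
  refine ⟨(C₁ + 1) * C₂ + C₃ * C₄, Real.log q, by positivity, hlq, fun s hs ↦ ?_⟩
  have hsre : s.re ≤ ‖s‖ := re_le_norm s
  set x : ℝ := ‖s‖ + 2 with hx
  have hx2 : 2 ≤ x := by have := norm_nonneg s; linarith
  have hlx : 0 ≤ Real.log x := Real.log_nonneg (by linarith)
  have hqs : ‖(q : ℂ) ^ (s / 2)‖ ≤ Real.exp (Real.log q * ‖s‖) := by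
    rw [norm_natCast_cpow_of_pos (NeZero.pos q), Real.rpow_def_of_pos (by linarith)]
    refine Real.exp_le_exp.mpr (mul_le_mul_of_nonneg_left ?_ hlq)
    simp; linarith
  have hxsq : x ^ 2 ≤ Real.exp (2 * (x * Real.log x)) := by
    rw [← Real.exp_log (show 0 < x ^ 2 by positivity), Real.log_pow]
    refine Real.exp_le_exp.mpr ?_
    push_cast
    nlinarith
  have hpoly : ‖s * (1 - s)‖ ≤ x ^ 2 - 1 := by
    rw [norm_mul]
    have : ‖1 - s‖ ≤ 1 + ‖s‖ := (norm_sub_le _ _).trans_eq (by simp)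
    nlinarith [norm_nonneg s]
  rw [Real.exp_add]
  rcases le_total s.re 2 with h2 | h2
  · have hE : Real.exp (2 * (x * Real.log x)) ≤ Real.exp (4 * (x * Real.log x)) :=
      Real.exp_le_exp.mpr (by nlinarith [mul_nonneg (show 0 ≤ x by linarith) hlx])
    have hζ : ‖s * (1 - s) * completedRiemannZeta₀ s - 1‖ ≤ (C₁ + 1) * x ^ 2 := by
      refine (norm_sub_le _ _).trans ?_
      rw [norm_mul, norm_one]
      have := mul_le_mul hpoly (hC₁ s hs h2) (norm_nonneg _) (by nlinarith)
      rw [HurwitzZeta.completedHurwitzZetaEven₀_zero] at this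
      nlinarith
    rw [xiProduct, norm_mul, norm_mul]
    calc _ ≤ (C₁ + 1) * Real.exp (4 * (x * Real.log x)) * Real.exp (Real.log q * ‖s‖) * C₂ := by
          gcongr
          · exact hζ.trans (mul_le_mul_of_nonneg_left (hxsq.trans hE) (by positivity))
          · exact hC₂ s hs h2
      _ = (C₁ + 1) * C₂ * (Real.exp (Real.log q * ‖s‖) * Real.exp (4 * (x * Real.log x))) := by ring
      _ ≤ _ := by gcongr; nlinarith [mul_nonneg hC₃0 hC₄0]
  · have hΓ : ‖Gammaℝ s‖ ≤ Real.exp (x * Real.log x) := norm_Gammaℝ_le h2 (by linarith)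
    have hγ : ‖gammaFactor χ s‖ ≤ Real.exp (x * Real.log x) := by
      rcases χ.even_or_odd with h | h <;> rw [h.gammaFactor_def]
      · exact hΓ
      · exact norm_Gammaℝ_le (by simp; linarith) (by simp; linarith)
    have hζ : ‖riemannZeta s‖ ≤ C₃ := by
      rw [← LSeries_one_eq_riemannZeta (by linarith)]; exact hC₃ s h2
    have hL : ‖LFunction χ s‖ ≤ C₄ := by
      rw [LFunction_eq_LSeries χ (by linarith)]; exact hC₄ s h2
    rw [xiProduct_eq χ (by linarith)]
    simp only [norm_mul _ (LFunction χ s), norm_mul _ (gammaFactor χ s), norm_mul _ (Gammaℝ s),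
      norm_mul _ (riemannZeta s), norm_mul _ ((q : ℂ) ^ (s / 2))]
    calc _ ≤ Real.exp (2 * (x * Real.log x)) * Real.exp (x * Real.log x) * C₃ *
          Real.exp (Real.log q * ‖s‖) * Real.exp (x * Real.log x) * C₄ := by
          gcongr
          linarith
      _ = C₃ * C₄ * (Real.exp (Real.log q * ‖s‖) * Real.exp (4 * (x * Real.log x))) := by
          rw [show 4 * (x * Real.log x) = 2 * (x * Real.log x) + x * Real.log x + x * Real.log x by
            ring, Real.exp_add, Real.exp_add]
          ring
      _ ≤ _ := by gcongr; nlinarith [mul_nonneg (add_nonneg hC₁0 zero_le_one) hC₂0]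

lemma eventually_growth_le {C K ε : ℝ} (hε : 0 < ε) :
    ∀ᶠ r : ℝ in Filter.atTop, C * Real.exp (K * r + 4 * ((r + 2) * Real.log (r + 2))) ≤
      Real.exp (ε * r ^ 2) := by
  have hlog : ∀ᶠ r : ℝ in Filter.atTop, Real.log (r + 2) ≤ ε / 64 * (r + 2) := by
    have h1 := (Real.isLittleO_log_id_atTop.def (show 0 < ε / 64 by positivity))
    have h2 : Filter.Tendsto (fun r : ℝ ↦ r + 2) Filter.atTop Filter.atTop :=
      Filter.tendsto_atTop_add_const_right _ _ Filter.tendsto_id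
    filter_upwards [h2.eventually h1, Filter.eventually_ge_atTop 0] with r hr hr0
    rw [id, Real.norm_of_nonneg (by linarith : (0 : ℝ) ≤ r + 2)] at hr
    exact (le_abs_self _).trans hr
  filter_upwards [hlog, Filter.eventually_ge_atTop 2, Filter.eventually_ge_atTop (4 * K / ε),
    Filter.eventually_ge_atTop (4 * C / ε)] with r h1 h2 h3 h4
  rw [div_le_iff₀ hε] at h3 h4
  have h5 : C ≤ Real.exp (ε * r ^ 2 / 4) := by
    refine (le_trans ?_ (Real.add_one_le_exp _))
    nlinarith [mul_pos hε (show 0 < r by linarith)]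
  calc _ ≤ Real.exp (ε * r ^ 2 / 4) * Real.exp (K * r + 4 * ((r + 2) * Real.log (r + 2))) := by
        gcongr
    _ ≤ _ := by
      rw [← Real.exp_add]
      refine Real.exp_le_exp.mpr ?_
      have h6 : (r + 2) * Real.log (r + 2) ≤ (r + 2) * (ε / 64 * (r + 2)) := by gcongr
      have h7 : K * r ≤ ε * r ^ 2 / 4 := by nlinarith
      have h8 : ε * (r + 2) ^ 2 ≤ ε * (2 * r) ^ 2 := by gcongr; linarith
      have h9 : 0 ≤ ε * r ^ 2 := by positivity
      linarith

lemma xiProduct_growth (hχ : χ ≠ 1) (hprim : χ.IsPrimitive) (hinv : χ⁻¹ = χ) {ε : ℝ}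
    (hε : 0 < ε) :
    ∃ R₀, ∀ z : ℂ, R₀ ≤ ‖z‖ → ‖χ.xiProduct (1 / 2 + z)‖ ≤ Real.exp (ε * ‖z‖ ^ 2) := by
  obtain ⟨C, K, hC, hK, hbd⟩ := exists_norm_xiProduct_le hχ
  have h1 : Filter.Tendsto (fun r : ℝ ↦ r + 1) Filter.atTop Filter.atTop :=
    Filter.tendsto_atTop_add_const_right _ _ Filter.tendsto_id
  obtain ⟨R₀, hR₀⟩ := Filter.eventually_atTop.mp (h1.eventually
    (eventually_growth_le (C := (1 + ‖rootNumber χ‖) * C) (K := K) (show 0 < ε / 4 by positivity)))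
  have key : ∀ z : ℂ, 0 ≤ z.re → max R₀ 1 ≤ ‖z‖ →
      (1 + ‖rootNumber χ‖) * ‖χ.xiProduct (1 / 2 + z)‖ ≤ Real.exp (ε * ‖z‖ ^ 2) := by
    intro z hz hR
    obtain ⟨hR1, hR2⟩ := max_le_iff.mp hR
    have hs : ‖1 / 2 + z‖ ≤ ‖z‖ + 1 := by
      have h := norm_add_le (1 / 2 : ℂ) z
      have h' : ‖(1 / 2 : ℂ)‖ = 1 / 2 := by simp
      linarith
    have hlog : 0 ≤ Real.log (‖1 / 2 + z‖ + 2) :=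
      Real.log_nonneg (by linarith [norm_nonneg (1 / 2 + z)])
    calc _ ≤ (1 + ‖rootNumber χ‖) * (C * Real.exp (K * ‖1 / 2 + z‖ +
            4 * ((‖1 / 2 + z‖ + 2) * Real.log (‖1 / 2 + z‖ + 2)))) := by
          gcongr
          exact hbd _ (by simpa using hz)
      _ ≤ (1 + ‖rootNumber χ‖) * (C * Real.exp (K * (‖z‖ + 1) +
            4 * ((‖z‖ + 1 + 2) * Real.log (‖z‖ + 1 + 2)))) := by
          gcongr
      _ ≤ Real.exp (ε / 4 * (‖z‖ + 1) ^ 2) := by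
          rw [← mul_assoc]; exact hR₀ _ hR1
      _ ≤ _ := by
          have h2 : ε * (‖z‖ + 1) ^ 2 ≤ ε * (2 * ‖z‖) ^ 2 := by gcongr; linarith
          exact Real.exp_le_exp.mpr (by linarith)
  refine ⟨max R₀ 1, fun z hz ↦ ?_⟩
  rcases le_total 0 z.re with h | h
  · have := key z h hz
    nlinarith [mul_nonneg (norm_nonneg (rootNumber χ)) (norm_nonneg (χ.xiProduct (1 / 2 + z)))]
  · have := key (-z) (by simpa using h) (by simpa using hz)
    have h2 := xiProduct_one_sub hprim hinv (1 / 2 + -z)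
    rw [show 1 - (1 / 2 + -z) = 1 / 2 + z by ring] at h2
    rw [h2, norm_mul]
    rw [norm_neg] at this
    nlinarith [norm_nonneg (χ.xiProduct (1 / 2 + -z))]

end DirichletCharacter

/-- The combined contribution of the zeros `ρ` and `1 - ρ` to the partial fraction expansion of the
logarithmic derivative at the points `σ i`, with weights `w i`. -/
noncomputable def zeroKernel {ι : Type*} (S : Finset ι) (w σ : ι → ℝ) (ρ : ℂ) : ℂ :=
  ∑ i ∈ S, (w i : ℂ) * (1 / (σ i - ρ) + 1 / (σ i - 1 + ρ))

lemma re_logDeriv_Gammaℝ {x : ℝ} (hx : 0 < x) :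
    (logDeriv Gammaℝ x).re = -(Real.log π) / 2 + (digamma ((x / 2 : ℝ) : ℂ)).re / 2 := by
  have hx' : (x : ℂ) / 2 = ((x / 2 : ℝ) : ℂ) := by push_cast; ring
  have hne : ∀ m : ℕ, (x : ℂ) / 2 ≠ -m := by
    intro m h
    have := congrArg re h
    rw [hx', ofReal_re] at this
    simp only [neg_re, natCast_re] at this
    have : (0 : ℝ) ≤ m := Nat.cast_nonneg m
    linarith
  have hπ : (π : ℂ) ≠ 0 := by exact_mod_cast Real.pi_ne_zero
  have h1 : HasDerivAt (fun s : ℂ ↦ (π : ℂ) ^ (-s / 2))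
      ((π : ℂ) ^ (-(x : ℂ) / 2) * Complex.log π * (-1 / 2)) x :=
    ((hasDerivAt_id (x : ℂ)).neg.div_const 2).const_cpow (.inl hπ)
  have h2 : HasDerivAt (fun s : ℂ ↦ Gamma (s / 2)) (deriv Gamma ((x : ℂ) / 2) * (1 / 2)) x :=
    (differentiableAt_Gamma _ hne).hasDerivAt.comp (x : ℂ) ((hasDerivAt_id (x : ℂ)).div_const 2)
  have hΓ : Gamma ((x : ℂ) / 2) ≠ 0 := Gamma_ne_zero hne
  have hp : (π : ℂ) ^ (-(x : ℂ) / 2) ≠ 0 := by simp [cpow_eq_zero_iff, hπ]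
  have key : logDeriv Gammaℝ x = -Complex.log π / 2 + digamma ((x : ℂ) / 2) / 2 := by
    have : Gammaℝ = fun s ↦ (π : ℂ) ^ (-s / 2) * Gamma (s / 2) := rfl
    rw [this, logDeriv_mul (f := fun s : ℂ ↦ (π : ℂ) ^ (-s / 2)) (g := fun s ↦ Gamma (s / 2)) (x : ℂ)
      hp hΓ h1.differentiableAt h2.differentiableAt, logDeriv_apply,
      logDeriv_apply, h1.deriv, h2.deriv, digamma_def, logDeriv_apply]
    field_simp
  rw [key, hx', ← ofReal_log Real.pi_pos.le]
  simp

lemma exists_gammaFactor_eq {q : ℕ} (χ : DirichletCharacter ℂ q) :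
    ∃ a : ℝ, 0 ≤ a ∧ a ≤ 1 ∧ ∀ s, χ.gammaFactor s = Gammaℝ (s + a) := by
  rcases χ.even_or_odd with h | h
  · exact ⟨0, le_rfl, zero_le_one, fun s ↦ by simp [h.gammaFactor_def]⟩
  · exact ⟨1, zero_le_one, le_rfl, fun s ↦ by simp [h.gammaFactor_def]⟩

namespace DirichletCharacter

variable {q : ℕ} [NeZero q] {χ : DirichletCharacter ℂ q}

lemma re_logDeriv_xiProduct (hχ : χ ≠ 1) {a : ℝ} (ha0 : 0 ≤ a)
    (ha : ∀ s, χ.gammaFactor s = Gammaℝ (s + a)) {x : ℝ} (hx : 1 < x) :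
    (logDeriv χ.xiProduct x).re = 1 / x + 1 / (x - 1) + Real.log q / 2 - Real.log π +
      (digamma ((x / 2 : ℝ) : ℂ)).re / 2 + (digamma (((x + a) / 2 : ℝ) : ℂ)).re / 2 +
      (logDeriv riemannZeta x).re + (logDeriv (LFunction χ) x).re := by
  have hq : (q : ℂ) ≠ 0 := NeZero.ne _
  have hxre : 1 < (x : ℂ).re := by simpa
  have hx0 : (x : ℂ) ≠ 0 := by exact_mod_cast (by linarith : x ≠ 0)
  have hx1 : (x : ℂ) ≠ 1 := by exact_mod_cast hx.ne'
  have hx1' : 1 - (x : ℂ) ≠ 0 := sub_ne_zero.mpr hx1.symm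
  have hev : χ.xiProduct =ᶠ[nhds (x : ℂ)] fun s ↦ (s * (1 - s)) * (Gammaℝ s * (riemannZeta s *
      ((q : ℂ) ^ (s / 2) * (Gammaℝ (s + a) * LFunction χ s)))) := by
    have hopen : IsOpen {s : ℂ | 1 < s.re} := isOpen_lt continuous_const continuous_re
    filter_upwards [hopen.mem_nhds hxre] with s hs
    rw [xiProduct_eq χ hs, ha]
    ring
  have hΓd : ∀ y : ℂ, 0 < y.re → DifferentiableAt ℂ Gammaℝ y := by
    intro y hy
    have h := (differentiable_Gammaℝ_inv y).inv (inv_ne_zero (Gammaℝ_ne_zero_of_re_pos hy))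
    have heq : Gammaℝ = (fun s ↦ (Gammaℝ s)⁻¹)⁻¹ := by ext; simp
    rwa [← heq] at h
  have hxa : 0 < ((x : ℂ) + a).re := by simp; linarith
  have d1 : DifferentiableAt ℂ (fun s : ℂ ↦ s * (1 - s)) x := by fun_prop
  have d2 : DifferentiableAt ℂ Gammaℝ x := hΓd _ (by simp; linarith)
  have d3 : DifferentiableAt ℂ riemannZeta x := differentiableAt_riemannZeta hx1
  have d4 : DifferentiableAt ℂ (fun s : ℂ ↦ (q : ℂ) ^ (s / 2)) x := by
    fun_prop (disch := simp [NeZero.ne q])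
  have d5 : DifferentiableAt ℂ (fun s : ℂ ↦ Gammaℝ (s + a)) x := by
    have : DifferentiableAt ℂ (fun s : ℂ ↦ s + a) x := by fun_prop
    exact DifferentiableAt.comp (x : ℂ) (hΓd _ hxa) this
  have d6 : DifferentiableAt ℂ (LFunction χ) x := differentiable_LFunction hχ _
  have n2 : Gammaℝ x ≠ 0 := Gammaℝ_ne_zero_of_re_pos (by simp; linarith)
  have n3 : riemannZeta x ≠ 0 := riemannZeta_ne_zero_of_one_le_re hxre.le
  have n4 : (q : ℂ) ^ ((x : ℂ) / 2) ≠ 0 := by simp [cpow_eq_zero_iff, hq]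
  have n5 : Gammaℝ (x + a) ≠ 0 := Gammaℝ_ne_zero_of_re_pos hxa
  have n6 : LFunction χ x ≠ 0 := LFunction_ne_zero_of_one_le_re χ (.inl hχ) hxre.le
  have e1 : logDeriv (fun s : ℂ ↦ s * (1 - s)) x = ((1 / x + 1 / (x - 1) : ℝ) : ℂ) := by
    have h : HasDerivAt (fun s : ℂ ↦ s * (1 - s)) (1 * (1 - x) + x * (-1)) x :=
      (hasDerivAt_id (x : ℂ)).mul ((hasDerivAt_id (x : ℂ)).const_sub 1)
    have hx1'' : (x : ℂ) - 1 ≠ 0 := sub_ne_zero.mpr hx1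
    rw [logDeriv_apply, h.deriv]
    push_cast
    rw [show 1 - (x : ℂ) = -((x : ℂ) - 1) by ring]
    field_simp
    ring
  have e4 : logDeriv (fun s : ℂ ↦ (q : ℂ) ^ (s / 2)) x = ((Real.log q / 2 : ℝ) : ℂ) := by
    have h : HasDerivAt (fun s : ℂ ↦ (q : ℂ) ^ (s / 2))
        ((q : ℂ) ^ ((x : ℂ) / 2) * Complex.log q * (1 / 2)) x :=
      ((hasDerivAt_id (x : ℂ)).div_const 2).const_cpow (.inl hq)
    rw [logDeriv_apply, h.deriv, ← natCast_log]
    push_cast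
    field_simp
  have e5 : logDeriv (fun s : ℂ ↦ Gammaℝ (s + a)) x = logDeriv Gammaℝ ((x + a : ℝ) : ℂ) := by
    rw [logDeriv_apply, logDeriv_apply, deriv_comp_add_const]
    push_cast
    rfl
  have m5 : logDeriv (fun s : ℂ ↦ Gammaℝ (s + a) * LFunction χ s) x =
      logDeriv (fun s : ℂ ↦ Gammaℝ (s + a)) x + logDeriv (LFunction χ) x :=
    logDeriv_mul (f := fun s : ℂ ↦ Gammaℝ (s + a)) (x : ℂ) n5 n6 d5 d6
  have m4 : logDeriv (fun s : ℂ ↦ (q : ℂ) ^ (s / 2) * (Gammaℝ (s + a) * LFunction χ s)) x =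
      logDeriv (fun s : ℂ ↦ (q : ℂ) ^ (s / 2)) x +
        logDeriv (fun s : ℂ ↦ Gammaℝ (s + a) * LFunction χ s) x :=
    logDeriv_mul (f := fun s : ℂ ↦ (q : ℂ) ^ (s / 2)) (x : ℂ) n4 (mul_ne_zero n5 n6) d4 (d5.mul d6)
  have m3 := logDeriv_mul (f := riemannZeta)
    (g := fun s ↦ (q : ℂ) ^ (s / 2) * (Gammaℝ (s + a) * LFunction χ s)) (x : ℂ) n3
    (mul_ne_zero n4 (mul_ne_zero n5 n6)) d3 (d4.mul (d5.mul d6))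
  have m2 := logDeriv_mul (f := Gammaℝ) (g := fun s ↦ riemannZeta s *
    ((q : ℂ) ^ (s / 2) * (Gammaℝ (s + a) * LFunction χ s))) (x : ℂ) n2
    (mul_ne_zero n3 (mul_ne_zero n4 (mul_ne_zero n5 n6))) d2 (d3.mul (d4.mul (d5.mul d6)))
  have m1 := logDeriv_mul (f := fun s : ℂ ↦ s * (1 - s)) (g := fun s ↦ Gammaℝ s *
    (riemannZeta s * ((q : ℂ) ^ (s / 2) * (Gammaℝ (s + a) * LFunction χ s)))) (x : ℂ)
    (mul_ne_zero hx0 hx1')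
    (mul_ne_zero n2 (mul_ne_zero n3 (mul_ne_zero n4 (mul_ne_zero n5 n6)))) d1
    (d2.mul (d3.mul (d4.mul (d5.mul d6))))
  rw [logDeriv_apply, hev.deriv_eq, hev.self_of_nhds, ← logDeriv_apply
    (fun s ↦ (s * (1 - s)) * (Gammaℝ s * (riemannZeta s *
      ((q : ℂ) ^ (s / 2) * (Gammaℝ (s + a) * LFunction χ s))))), m1, m2, m3, m4, m5, e1, e4, e5]
  simp only [add_re, ofReal_re]
  rw [re_logDeriv_Gammaℝ (by linarith), re_logDeriv_Gammaℝ (by linarith)]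
  ring

end DirichletCharacter

namespace DirichletCharacter

variable {q : ℕ} [NeZero q] {χ : DirichletCharacter ℂ q}

lemma half_sum_re_zeroKernel_le {ι : Type*} (hχ : χ ≠ 1) (hprim : χ.IsPrimitive)
    (hinv : χ⁻¹ = χ) (S : Finset ι) (w σ : ι → ℝ) (hσ : ∀ i ∈ S, 1 < σ i)
    (hker : ∀ ρ : ℂ, 0 ≤ ρ.re → ρ.re ≤ 1 → 0 ≤ (zeroKernel S w σ ρ).re)
    (T : Finset ℂ) (hT : ∀ ρ ∈ T, χ.xiProduct ρ = 0) :
    1 / 2 * ∑ ρ ∈ T, (zeroKernel S w σ ρ).re ≤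
      ∑ i ∈ S, w i * (logDeriv χ.xiProduct (σ i)).re := by
  refine le_of_forall_pos_le_add fun δ hδ ↦ ?_
  set W : ℝ := ∑ i ∈ S, |w i| + 1 with hW
  have hWnn : 0 ≤ ∑ i ∈ S, |w i| := Finset.sum_nonneg fun _ _ ↦ abs_nonneg _
  have hW0 : 0 < W := by positivity
  set B : ℝ := 1 + ∑ i ∈ S, |σ i| + ∑ ρ ∈ T, ‖ρ‖ with hB
  have hS0 : 0 ≤ ∑ i ∈ S, |σ i| := Finset.sum_nonneg fun _ _ ↦ abs_nonneg _
  have hT0 : 0 ≤ ∑ ρ ∈ T, ‖ρ‖ := Finset.sum_nonneg fun _ _ ↦ norm_nonneg _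
  set f : ℂ → ℂ := fun z ↦ χ.xiProduct (1 / 2 + z) with hf
  have hfd : Differentiable ℂ f :=
    (differentiable_xiProduct hχ).comp ((differentiable_const _).add differentiable_id)
  obtain ⟨M, hM0, hM1, hM⟩ := exists_multiset_logDeriv_approx hfd (c := rootNumber χ)
    (fun z ↦ by
      simp only [hf]
      rw [← xiProduct_one_sub hprim hinv]
      congr 1
      ring)
    (z₀ := 3 / 2) (xiProduct_ne_zero χ (by norm_num)) (fun ε hε ↦ xiProduct_growth hχ hprim hinv hε)
    (B := B) (by positivity) (div_pos hδ hW0)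
  have hlog : ∀ z, logDeriv f z = logDeriv χ.xiProduct (1 / 2 + z) := by
    intro z
    rw [logDeriv_apply, logDeriv_apply, hf, deriv_comp_const_add]
  have hterm : ∀ i ∈ S, 1 / 2 * (w i * ((M.map fun ρ ↦ 1 / ((σ i : ℂ) - 1 / 2 - ρ) +
      1 / ((σ i : ℂ) - 1 / 2 + ρ)).sum).re) ≤
      w i * (logDeriv χ.xiProduct (σ i)).re + |w i| * (δ / W) := by
    intro i hi
    have hne : f ((σ i : ℂ) - 1 / 2) ≠ 0 := by
      simp only [hf]
      refine xiProduct_ne_zero χ ?_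
      simpa using hσ i hi
    have hnorm : ‖(σ i : ℂ) - 1 / 2‖ ≤ B := by
      refine (norm_sub_le _ _).trans ?_
      have : |σ i| ≤ ∑ i ∈ S, |σ i| :=
        Finset.single_le_sum (f := fun i ↦ |σ i|) (fun _ _ ↦ abs_nonneg _) hi
      rw [norm_real, Real.norm_eq_abs]
      have h2 : ‖(1 / 2 : ℂ)‖ = 1 / 2 := by norm_num
      rw [h2]
      linarith
    have h := hM _ hnorm hne
    rw [hlog, show (1 / 2 : ℂ) + ((σ i : ℂ) - 1 / 2) = σ i by ring] at h
    set P := (M.map fun ρ ↦ 1 / ((σ i : ℂ) - 1 / 2 - ρ) + 1 / ((σ i : ℂ) - 1 / 2 + ρ)).sum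
    have h3 := (abs_re_le_norm _).trans h
    have h4 : (logDeriv χ.xiProduct (σ i) - 1 / 2 * P).re =
        (logDeriv χ.xiProduct (σ i)).re - 1 / 2 * P.re := by simp
    rw [h4] at h3
    have h5 := mul_le_mul_of_nonneg_left h3 (abs_nonneg (w i))
    rw [← abs_mul] at h5
    have h6 := (neg_abs_le _).trans' (neg_le_neg h5)
    linarith
  have hsum := Finset.sum_le_sum hterm
  rw [Finset.sum_add_distrib, ← Finset.sum_mul, ← Finset.mul_sum] at hsum
  have hsmall : (∑ i ∈ S, |w i|) * (δ / W) ≤ δ := by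
    rw [mul_div_assoc', div_le_iff₀ hW0, mul_comm]
    exact mul_le_mul_of_nonneg_left (by linarith) hδ.le
  have hswap : ∑ i ∈ S, w i * ((M.map fun ρ ↦ 1 / ((σ i : ℂ) - 1 / 2 - ρ) +
      1 / ((σ i : ℂ) - 1 / 2 + ρ)).sum).re =
      (M.map fun ρ ↦ (zeroKernel S w σ (1 / 2 + ρ)).re).sum := by
    clear hM hM0 hM1 hterm hsum
    induction M using Multiset.induction_on with
    | empty => simp
    | cons ρ M ih =>
      simp only [Multiset.map_cons, Multiset.sum_cons, add_re, mul_add, Finset.sum_add_distrib]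
      rw [ih, zeroKernel, re_sum]
      congr 1
      rw [← Finset.sum_add_distrib]
      refine Finset.sum_congr rfl fun i _ ↦ ?_
      rw [re_ofReal_mul, ← mul_add, ← add_re]
      congr 4 <;> ring
  have hle : (T.val.map (· - 1 / 2)) ≤ M := by
    rw [Multiset.le_iff_subset ((Multiset.nodup_map_iff_of_injective
      (sub_left_injective)).mpr T.nodup)]
    intro z hz
    obtain ⟨ρ, hρ, rfl⟩ := Multiset.mem_map.mp hz
    have hρ' : ρ ∈ T := hρ
    refine hM1 _ ?_ ?_
    · simp only [hf]
      rw [show (1 / 2 : ℂ) + (ρ - 1 / 2) = ρ by ring]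
      exact hT ρ hρ'
    · refine (norm_sub_le _ _).trans ?_
      have : ‖ρ‖ ≤ ∑ ρ ∈ T, ‖ρ‖ :=
        Finset.single_le_sum (f := fun ρ : ℂ ↦ ‖ρ‖) (fun _ _ ↦ norm_nonneg _) hρ'
      have h2 : ‖(1 / 2 : ℂ)‖ = 1 / 2 := by norm_num
      rw [h2]
      linarith
  obtain ⟨R, rfl⟩ := Multiset.le_iff_exists_add.mp hle
  have hR : 0 ≤ (R.map fun ρ ↦ (zeroKernel S w σ (1 / 2 + ρ)).re).sum := by
    refine Multiset.sum_nonneg fun x hx ↦ ?_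
    obtain ⟨ρ, hρ, rfl⟩ := Multiset.mem_map.mp hx
    have h := re_mem_Icc_of_xiProduct_eq_zero hprim hinv (hM0 ρ (Multiset.mem_add.mpr (.inr hρ)))
    exact hker _ h.1 h.2
  have hTs : ((T.val.map (· - 1 / 2)).map fun ρ ↦ (zeroKernel S w σ (1 / 2 + ρ)).re).sum =
      ∑ ρ ∈ T, (zeroKernel S w σ ρ).re := by
    rw [Multiset.map_map]
    refine Finset.sum_congr rfl fun ρ _ ↦ ?_
    simp
  rw [hswap, Multiset.map_add, Multiset.sum_add, hTs] at hsum
  linarith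

lemma hasSum_re_logDeriv (χ : DirichletCharacter ℂ q) {x : ℝ} (hx : 1 < x) :
    HasSum (fun n : ℕ ↦ (1 + (χ n).re) * ArithmeticFunction.vonMangoldt n * (n : ℝ) ^ (-x))
      (-((logDeriv riemannZeta x).re + (logDeriv (LFunction χ) x).re)) := by
  have hxre : 1 < (x : ℂ).re := by simpa
  have h1 := (ArithmeticFunction.LSeriesSummable_vonMangoldt hxre).LSeriesHasSum
  have h2 := (LSeriesSummable_twist_vonMangoldt χ hxre).LSeriesHasSum
  rw [ArithmeticFunction.LSeries_vonMangoldt_eq_deriv_riemannZeta_div hxre] at h1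
  rw [LSeries_twist_vonMangoldt_eq χ hxre, ← deriv_LFunction_eq_deriv_LSeries χ hxre,
    ← LFunction_eq_LSeries χ hxre] at h2
  have h3 := reCLM.hasSum (h1.add h2)
  convert h3 using 1
  · ext n
    rcases eq_or_ne n 0 with rfl | hn
    · simp
    · simp only [LSeries.term_of_ne_zero hn, reCLM_apply, Pi.add_apply, Pi.mul_apply]
      have : (n : ℂ) ^ (x : ℂ) = (((n : ℝ) ^ x : ℝ) : ℂ) := by
        rw [ofReal_cpow (Nat.cast_nonneg n)]; simp
      rw [this, div_ofReal_re, add_re, re_mul_ofReal, ofReal_re,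
        Real.rpow_neg (Nat.cast_nonneg n)]
      field_simp
  · simp [logDeriv_apply, neg_div]
    ring

lemma sum_mul_re_logDeriv_le {ι : Type*} (χ : DirichletCharacter ℂ q) (S : Finset ι) (w σ : ι → ℝ)
    (hσ : ∀ i ∈ S, 1 < σ i)
    (hpos : ∀ n : ℕ, n ≠ 0 → 0 ≤ ∑ i ∈ S, w i * (n : ℝ) ^ (-σ i)) :
    ∑ i ∈ S, w i * ((logDeriv riemannZeta (σ i)).re + (logDeriv (LFunction χ) (σ i)).re) ≤ 0 := by
  have h := hasSum_sum fun i hi ↦ (hasSum_re_logDeriv χ (hσ i hi)).mul_left (w i)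
  have h2 : 0 ≤ ∑ i ∈ S, w i * (-((logDeriv riemannZeta (σ i)).re +
      (logDeriv (LFunction χ) (σ i)).re)) := by
    refine h.nonneg fun n ↦ ?_
    have heq : ∑ i ∈ S, w i * ((1 + (χ n).re) * ArithmeticFunction.vonMangoldt n *
        (n : ℝ) ^ (-σ i)) = ((1 + (χ n).re) * ArithmeticFunction.vonMangoldt n) *
          ∑ i ∈ S, w i * (n : ℝ) ^ (-σ i) := by
      rw [Finset.mul_sum]
      exact Finset.sum_congr rfl fun i _ ↦ by ring
    rw [heq]
    rcases eq_or_ne n 0 with rfl | hn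
    · simp
    · refine mul_nonneg (mul_nonneg ?_ ArithmeticFunction.vonMangoldt_nonneg) (hpos n hn)
      have := (abs_le.mp ((abs_re_le_norm (χ n)).trans (χ.norm_le_one n))).1
      linarith
  simp only [mul_neg, Finset.sum_neg_distrib] at h2
  linarith

/-- The explicit formula inequality for `ζ(s) L(s, χ)` with real weights and real points. -/
lemma half_sum_re_zeroKernel_le_archimedean {ι : Type*} (hχ : χ ≠ 1) (hprim : χ.IsPrimitive)
    (hinv : χ⁻¹ = χ) {a : ℝ} (ha0 : 0 ≤ a) (ha : ∀ s, χ.gammaFactor s = Gammaℝ (s + a))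
    (S : Finset ι) (w σ : ι → ℝ) (hσ : ∀ i ∈ S, 1 < σ i)
    (hker : ∀ ρ : ℂ, 0 ≤ ρ.re → ρ.re ≤ 1 → 0 ≤ (zeroKernel S w σ ρ).re)
    (hpos : ∀ n : ℕ, n ≠ 0 → 0 ≤ ∑ i ∈ S, w i * (n : ℝ) ^ (-σ i))
    (T : Finset ℂ) (hT : ∀ ρ ∈ T, χ.xiProduct ρ = 0) :
    1 / 2 * ∑ ρ ∈ T, (zeroKernel S w σ ρ).re ≤
      (zeroKernel S w σ 0).re + (Real.log q / 2 - Real.log π) * ∑ i ∈ S, w i +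
        (∑ i ∈ S, w i * (digamma ((σ i / 2 : ℝ) : ℂ)).re) / 2 +
        (∑ i ∈ S, w i * (digamma (((σ i + a) / 2 : ℝ) : ℂ)).re) / 2 := by
  refine (half_sum_re_zeroKernel_le hχ hprim hinv S w σ hσ hker T hT).trans ?_
  have h := sum_mul_re_logDeriv_le χ S w σ hσ hpos
  have h0 : (zeroKernel S w σ 0).re = ∑ i ∈ S, w i * (1 / σ i + 1 / (σ i - 1)) := by
    rw [zeroKernel, re_sum]
    refine Finset.sum_congr rfl fun i _ ↦ ?_
    rw [re_ofReal_mul, sub_zero, add_zero]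
    norm_cast
  rw [h0, Finset.mul_sum, Finset.sum_div, Finset.sum_div]
  calc _ = ∑ i ∈ S, w i * (1 / σ i + 1 / (σ i - 1)) +
        ∑ i ∈ S, (Real.log q / 2 - Real.log π) * w i +
        ∑ i ∈ S, w i * (digamma ((σ i / 2 : ℝ) : ℂ)).re / 2 +
        ∑ i ∈ S, w i * (digamma (((σ i + a) / 2 : ℝ) : ℂ)).re / 2 +
        ∑ i ∈ S, w i * ((logDeriv riemannZeta (σ i)).re + (logDeriv (LFunction χ) (σ i)).re) := by
        simp only [← Finset.sum_add_distrib]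
        refine Finset.sum_congr rfl fun i hi ↦ ?_
        rw [re_logDeriv_xiProduct hχ ha0 ha (hσ i hi)]
        ring
    _ ≤ _ := by linarith

end DirichletCharacter

lemma re_digamma_add_one {x : ℝ} (hx : 0 < x) :
    (digamma ((x + 1 : ℝ) : ℂ)).re = (digamma (x : ℂ)).re + 1 / x := by
  have hne : ∀ m : ℕ, (x : ℂ) ≠ -m := by
    intro m h
    have := congrArg re h
    simp only [ofReal_re, neg_re, natCast_re] at this
    have : (0 : ℝ) ≤ m := Nat.cast_nonneg m
    linarith
  rw [ofReal_add, ofReal_one, digamma_apply_add_one _ hne, add_re, ← ofReal_inv, ofReal_re,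
    one_div]

lemma re_digamma_add_natCast {x : ℝ} (hx : 0 < x) (N : ℕ) :
    (digamma ((x + N : ℝ) : ℂ)).re =
      (digamma (x : ℂ)).re + ∑ n ∈ Finset.range N, 1 / (x + n) := by
  induction N with
  | zero => simp
  | succ N ih =>
    rw [Finset.sum_range_succ, ← add_assoc, ← ih, ← re_digamma_add_one (by positivity)]
    congr 3
    push_cast
    ring

lemma hasDerivAt_log_Gamma {x : ℝ} (hx : 0 < x) :
    HasDerivAt (Real.log ∘ Real.Gamma) (digamma (x : ℂ)).re x := by
  have hne : ∀ m : ℕ, (x : ℂ) ≠ -m := by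
    intro m h
    have := congrArg re h
    simp only [ofReal_re, neg_re, natCast_re] at this
    have : (0 : ℝ) ≤ m := Nat.cast_nonneg m
    linarith
  have h := (differentiableAt_Gamma _ hne).hasDerivAt.real_of_complex
  have heq : (fun y : ℝ ↦ (Gamma y).re) = Real.Gamma := by
    ext y
    rw [Gamma_ofReal, ofReal_re]
  rw [heq] at h
  have h2 := h.log (Real.Gamma_pos_of_pos hx).ne'
  convert! h2 using 1
  rw [digamma_def, logDeriv_apply, Gamma_ofReal, div_ofReal_re]

lemma slope_log_Gamma {x : ℝ} (hx : 0 < x) :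
    slope (Real.log ∘ Real.Gamma) x (x + 1) = Real.log x := by
  rw [slope_def_field, add_sub_cancel_left, div_one, Function.comp_apply, Function.comp_apply,
    Real.Gamma_add_one hx.ne', Real.log_mul hx.ne' (Real.Gamma_pos_of_pos hx).ne']
  ring

lemma re_digamma_le_log {x : ℝ} (hx : 0 < x) : (digamma (x : ℂ)).re ≤ Real.log x := by
  rw [← slope_log_Gamma hx]
  exact Real.convexOn_log_Gamma.le_slope_of_hasDerivAt hx (by simp; linarith) (by linarith)
    (hasDerivAt_log_Gamma hx)

lemma log_le_re_digamma_add_one {x : ℝ} (hx : 0 < x) :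
    Real.log x ≤ (digamma ((x + 1 : ℝ) : ℂ)).re := by
  rw [← slope_log_Gamma hx]
  exact Real.convexOn_log_Gamma.slope_le_of_hasDerivAt hx (by simp; linarith) (by linarith)
    (hasDerivAt_log_Gamma (by linarith))

lemma tendsto_re_digamma_add_natCast_sub_log {x : ℝ} (hx : 0 < x) :
    Filter.Tendsto (fun N : ℕ ↦ (digamma ((x + N : ℝ) : ℂ)).re - Real.log N) Filter.atTop
      (nhds 0) := by
  have h (y : ℝ) : Filter.Tendsto (fun N : ℕ ↦ Real.log (N + y) - Real.log N) Filter.atTop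
      (nhds 0) := by
    have h1 := (Real.tendsto_log_comp_add_sub_log y).comp tendsto_natCast_atTop_atTop
    exact h1
  refine tendsto_of_tendsto_of_tendsto_of_le_of_le' (h (x - 1)) (h x) ?_ ?_
  · filter_upwards [Filter.eventually_ge_atTop 1] with N hN
    have hN' : (1 : ℝ) ≤ N := by exact_mod_cast hN
    have := log_le_re_digamma_add_one (show 0 < N + (x - 1) by linarith)
    rw [show (N : ℝ) + (x - 1) + 1 = x + N by ring] at this
    linarith
  · refine Filter.Eventually.of_forall fun N ↦ ?_
    have := re_digamma_le_log (show 0 < x + N by positivity)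
    rw [add_comm (N : ℝ) x]
    linarith

lemma tendsto_sum_mul_re_digamma {ι : Type*} (S : Finset ι) (v y : ι → ℝ)
    (hy : ∀ i ∈ S, 0 < y i) :
    Filter.Tendsto (fun N : ℕ ↦ (∑ i ∈ S, v i) * Real.log N -
      ∑ n ∈ Finset.range N, ∑ i ∈ S, v i * (1 / (y i + n))) Filter.atTop
      (nhds (∑ i ∈ S, v i * (digamma (y i : ℂ)).re)) := by
  have hlim := tendsto_finsetSum S fun i hi ↦
    ((tendsto_re_digamma_add_natCast_sub_log (hy i hi)).const_sub
      ((digamma (y i : ℂ)).re)).const_mul (v i)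
  simp only [sub_zero] at hlim
  refine hlim.congr fun N ↦ ?_
  rw [Finset.sum_comm, Finset.sum_mul, ← Finset.sum_sub_distrib]
  refine Finset.sum_congr rfl fun i hi ↦ ?_
  rw [re_digamma_add_natCast (hy i hi), ← Finset.mul_sum]
  ring

/-- A linear inequality between the functions `n ↦ 1 / (y + n)` gives an inequality between
the corresponding digamma values. -/
lemma sum_mul_re_digamma_le {ι κ : Type*} (S : Finset ι) (T : Finset κ) (v y : ι → ℝ) (p x : κ → ℝ)
    (hy : ∀ i ∈ S, 0 < y i) (hx : ∀ i ∈ T, 0 < x i) (hvp : ∑ i ∈ S, v i = ∑ i ∈ T, p i)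
    (h : ∀ n : ℕ, ∑ i ∈ T, p i * (1 / (x i + n)) ≤ ∑ i ∈ S, v i * (1 / (y i + n))) :
    ∑ i ∈ S, v i * (digamma (y i : ℂ)).re ≤ ∑ i ∈ T, p i * (digamma (x i : ℂ)).re := by
  refine le_of_tendsto_of_tendsto' (tendsto_sum_mul_re_digamma S v y hy)
    (tendsto_sum_mul_re_digamma T p x hx) fun N ↦ ?_
  rw [hvp]
  exact sub_le_sub_left (Finset.sum_le_sum fun n _ ↦ h n) _

/-- The alternating weights `1, -1, …, 1, -49/99` on `0, …, 49`. -/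
noncomputable def alternatingWeight (k : ℕ) : ℝ := if k = 49 then -49 / 99 else (-1) ^ k

lemma sum_alternatingWeight : ∑ k ∈ Finset.range 50, alternatingWeight k = 50 / 99 := by
  simp [Finset.sum_range_succ, alternatingWeight]
  norm_num

lemma le_sum_alternatingWeight_mul {G : ℕ → ℝ} (hG : ∀ k, G (k + 1) ≤ G k)
    (hG2 : ∀ k, G (k + 1) + G (k + 1) ≤ G k + G (k + 2)) :
    1 / 2 * G 0 + 1 / 198 * G 49 ≤ ∑ k ∈ Finset.range 50, alternatingWeight k * G k := by
  have h : ∀ m : ℕ, 1 / 2 * G 0 + 1 / 2 * G (2 * m) ≤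
      ∑ k ∈ Finset.range (2 * m + 1), (-1) ^ k * G k := by
    intro m
    induction m with
    | zero => simp; linarith
    | succ m ih =>
      rw [show 2 * (m + 1) + 1 = 2 * m + 1 + 1 + 1 by ring, Finset.sum_range_succ,
        Finset.sum_range_succ, Even.neg_one_pow (n := 2 * m + 1 + 1) ⟨m + 1, by ring⟩,
        Odd.neg_one_pow (n := 2 * m + 1) ⟨m, rfl⟩, show 2 * (m + 1) = 2 * m + 2 by ring]
      have := hG2 (2 * m)
      linarith
  have h24 := h 24
  rw [Finset.sum_range_succ]
  have h3 : ∑ k ∈ Finset.range 49, alternatingWeight k * G k =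
      ∑ k ∈ Finset.range (2 * 24 + 1), (-1) ^ k * G k := by
    refine Finset.sum_congr rfl fun k hk ↦ ?_
    rw [alternatingWeight, if_neg (by have := Finset.mem_range.mp hk; omega)]
  rw [h3, alternatingWeight, if_pos rfl]
  have h4 := hG 48
  norm_num at h24 h4 ⊢
  linarith

lemma sum_alternatingWeight_mul_add_succ (g : ℕ → ℝ) :
    ∑ k ∈ Finset.range 50, alternatingWeight k * (g (k + 1) + g k) =
      g 0 + 50 / 99 * g 49 - 49 / 99 * g 50 := by
  simp [Finset.sum_range_succ, alternatingWeight]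
  ring

lemma le_sum_alternatingWeight_mul_add {P Q : ℕ → ℝ} (hPQ : ∀ k, P (k + 1) ≤ Q k)
    (hPQ2 : ∀ k, Q (k + 1) + P (k + 1) ≤ Q k + P (k + 2)) (hQ : ∀ k, Q (k + 1) ≤ Q k)
    (hP : ∀ k, 0 ≤ P k) :
    P 0 ≤ ∑ k ∈ Finset.range 50, alternatingWeight k * (Q k + P k) := by
  have h : ∀ m : ℕ, P 0 + Q (2 * m) ≤
      ∑ k ∈ Finset.range (2 * m + 1), (-1) ^ k * (Q k + P k) := by
    intro m
    induction m with
    | zero => simp; linarith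
    | succ m ih =>
      rw [show 2 * (m + 1) + 1 = 2 * m + 1 + 1 + 1 by ring, Finset.sum_range_succ,
        Finset.sum_range_succ, Even.neg_one_pow (n := 2 * m + 1 + 1) ⟨m + 1, by ring⟩,
        Odd.neg_one_pow (n := 2 * m + 1) ⟨m, rfl⟩, show 2 * (m + 1) = 2 * m + 2 by ring]
      have := hPQ2 (2 * m)
      linarith
  have h24 := h 24
  rw [Finset.sum_range_succ]
  have h3 : ∑ k ∈ Finset.range 49, alternatingWeight k * (Q k + P k) =
      ∑ k ∈ Finset.range (2 * 24 + 1), (-1) ^ k * (Q k + P k) := by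
    refine Finset.sum_congr rfl fun k hk ↦ ?_
    rw [alternatingWeight, if_neg (by have := Finset.mem_range.mp hk; omega)]
  rw [h3, alternatingWeight, if_pos rfl]
  have h4 := hPQ 48
  have h5 := hQ 48
  have h6 := hP 49
  norm_num at h24 h4 h5 ⊢
  linarith

/-- A nonnegative decreasing function on `[0, ∞)` whose decrements are themselves decreasing. -/
structure IsDecreasingConvex (h : ℝ → ℝ) : Prop where
  nonneg : ∀ a, 0 ≤ a → 0 ≤ h a
  anti : ∀ a d, 0 ≤ a → 0 ≤ d → h (a + d) ≤ h a
  convex : ∀ a d e, 0 ≤ a → 0 ≤ d → 0 ≤ e → h (a + d) + h (a + e) ≤ h a + h (a + d + e)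

namespace IsDecreasingConvex

lemma one_div_add {r : ℝ} (hr : 0 < r) : IsDecreasingConvex fun u ↦ 1 / (u + r) where
  nonneg a ha := by positivity
  anti a d ha hd := one_div_le_one_div_of_le (by positivity) (by linarith)
  convex a d e ha hd he := by
    have h1 : 1 / (a + d + r) + 1 / (a + e + r) =
        (2 * (a + r) + d + e) / ((a + d + r) * (a + e + r)) := by
      field_simp; ring
    have h2 : 1 / (a + r) + 1 / (a + d + e + r) =
        (2 * (a + r) + d + e) / ((a + r) * (a + d + e + r)) := by
      field_simp; ring
    simp only [h1, h2]
    refine div_le_div_of_nonneg_left (by positivity) (by positivity) ?_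
    nlinarith [mul_nonneg hd he]

lemma add {g h : ℝ → ℝ} (hg : IsDecreasingConvex g) (hh : IsDecreasingConvex h) :
    IsDecreasingConvex fun u ↦ g u + h u where
  nonneg a ha := add_nonneg (hg.nonneg a ha) (hh.nonneg a ha)
  anti a d ha hd := add_le_add (hg.anti a d ha hd) (hh.anti a d ha hd)
  convex a d e ha hd he := by
    have := hg.convex a d e ha hd he
    have := hh.convex a d e ha hd he
    linarith

lemma const_mul {c : ℝ} (hc : 0 ≤ c) {h : ℝ → ℝ} (hh : IsDecreasingConvex h) :
    IsDecreasingConvex fun u ↦ c * h u where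
  nonneg a ha := mul_nonneg hc (hh.nonneg a ha)
  anti a d ha hd := mul_le_mul_of_nonneg_left (hh.anti a d ha hd) hc
  convex a d e ha hd he := by
    have := mul_le_mul_of_nonneg_left (hh.convex a d e ha hd he) hc
    linarith

lemma mul {g h : ℝ → ℝ} (hg : IsDecreasingConvex g) (hh : IsDecreasingConvex h) :
    IsDecreasingConvex fun u ↦ g u * h u where
  nonneg a ha := mul_nonneg (hg.nonneg a ha) (hh.nonneg a ha)
  anti a d ha hd := mul_le_mul (hg.anti a d ha hd) (hh.anti a d ha hd)
    (hh.nonneg _ (by positivity)) (hg.nonneg a ha)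
  convex a d e ha hd he := by
    have g1 := hg.convex a d e ha hd he
    have h1 := hh.convex a d e ha hd he
    have g2 := hg.anti (a + e) d (by positivity) hd
    have h2 := hh.anti (a + e) d (by positivity) hd
    have e1 : a + e + d = a + d + e := by ring
    rw [e1] at g2 h2
    have p1 := mul_nonneg (sub_nonneg.mpr g1) (hh.nonneg a ha)
    have p2 := mul_nonneg (sub_nonneg.mpr g2) (sub_nonneg.mpr (hh.anti a e ha he))
    have p3 := mul_nonneg (hg.nonneg (a + d) (by positivity)) (sub_nonneg.mpr h1)
    have p4 := mul_nonneg (sub_nonneg.mpr (hg.anti (a + d) e (by positivity) he))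
      (sub_nonneg.mpr h2)
    linarith

end IsDecreasingConvex

/-- The combination `11 / (u + 4 * t) - 16 / (u + 5 * t) + 6 / (u + 6 * t)`. -/
noncomputable def tripleKernel {K : Type*} [Field K] (t u : K) : K :=
  11 * (1 / (u + 4 * t)) - 16 * (1 / (u + 5 * t)) + 6 * (1 / (u + 6 * t))

lemma ofReal_tripleKernel (t u : ℝ) :
    ((tripleKernel t u : ℝ) : ℂ) = tripleKernel (t : ℂ) (u : ℂ) := by
  simp [tripleKernel]

lemma tripleKernel_eq {t u : ℝ} (ht : 0 < t) (hu : 0 ≤ u) :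
    tripleKernel t u = 1 / (u + 4 * t) + 4 * t * (1 / (u + 5 * t) * (1 / (u + 6 * t))) +
      20 * t ^ 2 * (1 / (u + 4 * t) * (1 / (u + 5 * t) * (1 / (u + 6 * t)))) := by
  unfold tripleKernel
  field_simp
  ring

lemma isDecreasingConvex_tripleKernel {t : ℝ} (ht : 0 < t) :
    IsDecreasingConvex (tripleKernel t) := by
  have h4 := IsDecreasingConvex.one_div_add (show 0 < 4 * t by positivity)
  have h5 := IsDecreasingConvex.one_div_add (show 0 < 5 * t by positivity)
  have h6 := IsDecreasingConvex.one_div_add (show 0 < 6 * t by positivity)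
  have h := (h4.add ((h5.mul h6).const_mul (show 0 ≤ 4 * t by positivity))).add
    ((h4.mul (h5.mul h6)).const_mul (show 0 ≤ 20 * t ^ 2 by positivity))
  constructor
  · intro a ha
    rw [tripleKernel_eq ht ha]
    exact h.nonneg a ha
  · intro a d ha hd
    rw [tripleKernel_eq ht ha, tripleKernel_eq ht (by positivity)]
    exact h.anti a d ha hd
  · intro a d e ha hd he
    rw [tripleKernel_eq ht ha, tripleKernel_eq ht (by positivity), tripleKernel_eq ht (by positivity),
      tripleKernel_eq ht (by positivity)]
    exact h.convex a d e ha hd he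

lemma one_div_le_tripleKernel {t u : ℝ} (ht : 0 < t) (hu : 0 ≤ u) :
    1 / (u + 4 * t) ≤ tripleKernel t u := by
  rw [tripleKernel_eq ht hu, add_assoc]
  exact le_add_of_nonneg_right (by positivity)

lemma tripleKernel_le_one_div {t u : ℝ} (ht : 0 < t) (hu : 0 < u) :
    tripleKernel t u ≤ 1 / u := by
  have h : 1 / u - tripleKernel t u = (8 * t ^ 2 * u + 120 * t ^ 3) /
      (u * ((u + 4 * t) * ((u + 5 * t) * (u + 6 * t)))) := by
    unfold tripleKernel
    field_simp
    ring
  rw [← sub_nonneg, h]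
  positivity

lemma sum_alternatingWeight_mul_tripleKernel_ge {t u : ℝ} (ht : 0 < t) (hu : 0 ≤ u) :
    1 / 2 * (1 / (u + 4 * t)) + 1 / 198 * (1 / (u + 49 + 4 * t)) ≤
      ∑ k ∈ Finset.range 50, alternatingWeight k * tripleKernel t (u + k) := by
  have hF := isDecreasingConvex_tripleKernel ht
  have h := le_sum_alternatingWeight_mul (G := fun k ↦ tripleKernel t (u + k))
    (fun k ↦ by
      have := hF.anti (u + k) 1 (by positivity) zero_le_one
      simpa [add_assoc] using this)
    (fun k ↦ by
      have := hF.convex (u + k) 1 1 (by positivity) zero_le_one zero_le_one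
      rw [show u + k + 1 + 1 = u + ((k + 2 : ℕ) : ℝ) by push_cast; ring] at this
      simpa [add_assoc] using this)
  have h0 := one_div_le_tripleKernel ht hu
  have h49 := one_div_le_tripleKernel ht (show 0 ≤ u + 49 by positivity)
  norm_num at h
  norm_num at h0 h49 ⊢
  linarith

lemma tripleKernel_le_sum_alternatingWeight_mul {t x : ℝ} (ht : 0 < t) (hx : 0 ≤ x)
    (hx2 : x ≤ 1 / 2) :
    tripleKernel t x ≤ ∑ k ∈ Finset.range 50,
      alternatingWeight k * (tripleKernel t (k + 1 - x) + tripleKernel t (k + x)) := by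
  have hF := isDecreasingConvex_tripleKernel ht
  have h := le_sum_alternatingWeight_mul_add (P := fun k ↦ tripleKernel t (k + x))
    (Q := fun k ↦ tripleKernel t (k + 1 - x))
    (fun k ↦ by
      have := hF.anti (k + 1 - x) (2 * x) (by have : (0 : ℝ) ≤ k := k.cast_nonneg; linarith)
        (by linarith)
      rw [show (k : ℝ) + 1 - x + 2 * x = k + 1 + x by ring] at this
      simpa using this)
    (fun k ↦ by
      have := hF.convex (k + 1 - x) 1 (2 * x)
        (by have : (0 : ℝ) ≤ k := k.cast_nonneg; linarith) zero_le_one (by linarith)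
      rw [show (k : ℝ) + 1 - x + 2 * x = (k + 1 : ℕ) + x by push_cast; ring,
        show (k : ℝ) + 1 - x + 1 + 2 * x = (k + 2 : ℕ) + x by push_cast; ring,
        show (k : ℝ) + 1 - x + 1 = (k + 1 : ℕ) + 1 - x by push_cast; ring] at this
      exact this)
    (fun k ↦ by
      have := hF.anti (k + 1 - x) 1 (by have : (0 : ℝ) ≤ k := k.cast_nonneg; linarith) zero_le_one
      rw [show (k : ℝ) + 1 - x + 1 = (k + 1 : ℕ) + 1 - x by push_cast; ring] at this
      exact this)
    (fun k ↦ hF.nonneg _ (by positivity))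
  simpa using h

lemma sum_alternatingWeight_mul_tripleKernel_le {t : ℝ} (ht : 0 < t) :
    ∑ k ∈ Finset.range 50, alternatingWeight k * (tripleKernel t (k + 1) + tripleKernel t k) ≤
      tripleKernel t 0 + 50 / 99 * (1 / 49) := by
  have h := sum_alternatingWeight_mul_add_succ fun k ↦ tripleKernel t (k : ℝ)
  push_cast at h
  rw [h]
  have h49 := tripleKernel_le_one_div ht (show (0 : ℝ) < 49 by norm_num)
  have h50 := (isDecreasingConvex_tripleKernel ht).nonneg 50 (by norm_num)
  linarith

lemma sum_alternatingWeight_mul_pow_nonneg {y : ℝ} (hy0 : 0 ≤ y) (hy1 : y ≤ 1) :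
    0 ≤ ∑ k ∈ Finset.range 50, alternatingWeight k * y ^ k := by
  refine le_trans ?_ (le_sum_alternatingWeight_mul (G := fun k ↦ y ^ k)
    (fun k ↦ pow_le_pow_of_le_one hy0 hy1 k.le_succ) (fun k ↦ ?_))
  · positivity
  · have := mul_nonneg (pow_nonneg hy0 k) (sq_nonneg (1 - y))
    ring_nf at this ⊢
    linarith

lemma re_one_div (z : ℂ) : (1 / z).re = z.re / (z.re ^ 2 + z.im ^ 2) := by
  rw [one_div, inv_re, normSq_apply]
  ring_nf

/-- The real part of `tripleKernel t (x + i y)` as a function of `x` and `y ^ 2`. -/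
lemma re_tripleKernel (t : ℝ) (z : ℂ) :
    (tripleKernel (t : ℂ) z).re =
      11 * ((z.re + 4 * t) / ((z.re + 4 * t) ^ 2 + z.im ^ 2)) -
      16 * ((z.re + 5 * t) / ((z.re + 5 * t) ^ 2 + z.im ^ 2)) +
      6 * ((z.re + 6 * t) / ((z.re + 6 * t) ^ 2 + z.im ^ 2)) := by
  have h (j : ℝ) : (1 / (z + (j : ℂ) * t)).re =
      (z.re + j * t) / ((z.re + j * t) ^ 2 + z.im ^ 2) := by
    rw [re_one_div]
    simp
  have h4 := h 4
  have h5 := h 5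
  have h6 := h 6
  push_cast at h4 h5 h6
  rw [tripleKernel, add_re, sub_re, ← h4, ← h5, ← h6]
  simp only [mul_re, re_ofNat, im_ofNat, zero_mul, sub_zero]

lemma re_tripleKernel_nonneg_of_re_eq_zero {t : ℝ} (ht : 0 < t) {z : ℂ} (hz : z.re = 0) :
    0 ≤ (tripleKernel (t : ℂ) z).re := by
  rw [re_tripleKernel, hz]
  have hY := sq_nonneg z.im
  set Y := z.im ^ 2
  have h : 11 * ((0 + 4 * t) / ((0 + 4 * t) ^ 2 + Y)) - 16 * ((0 + 5 * t) / ((0 + 5 * t) ^ 2 + Y)) +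
      6 * ((0 + 6 * t) / ((0 + 6 * t) ^ 2 + Y)) = 7920 * t ^ 5 / (((0 + 4 * t) ^ 2 + Y) *
        (((0 + 5 * t) ^ 2 + Y) * ((0 + 6 * t) ^ 2 + Y))) := by
    have h4 : (0 + 4 * t) ^ 2 + Y ≠ 0 := by positivity
    have h5 : (0 + 5 * t) ^ 2 + Y ≠ 0 := by positivity
    have h6 : (0 + 6 * t) ^ 2 + Y ≠ 0 := by positivity
    field_simp
    ring
  rw [h]
  positivity

lemma re_tripleKernel_fifty_le {t y : ℝ} (ht : 0 < t) :
    49 * (tripleKernel (t : ℂ) (50 + y * I)).re ≤ 50 * (tripleKernel (t : ℂ) (49 + y * I)).re := by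
  rw [re_tripleKernel, re_tripleKernel]
  simp only [add_re, add_im, re_ofNat, im_ofNat, mul_re, mul_im, ofReal_re, ofReal_im, I_re, I_im,
    mul_zero, mul_one, sub_zero, add_zero, zero_add]
  have hY := sq_nonneg y
  set Y := y ^ 2
  have hN (m : ℝ) (hm : 0 < m) : 11 * ((m + 4 * t) / ((m + 4 * t) ^ 2 + Y)) -
      16 * ((m + 5 * t) / ((m + 5 * t) ^ 2 + Y)) + 6 * ((m + 6 * t) / ((m + 6 * t) ^ 2 + Y)) =
      (11 * (m + 4 * t) * (((m + 5 * t) ^ 2 + Y) * ((m + 6 * t) ^ 2 + Y)) -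
        16 * (m + 5 * t) * (((m + 4 * t) ^ 2 + Y) * ((m + 6 * t) ^ 2 + Y)) +
        6 * (m + 6 * t) * (((m + 4 * t) ^ 2 + Y) * ((m + 5 * t) ^ 2 + Y))) / (((m + 4 * t) ^ 2 + Y) *
        (((m + 5 * t) ^ 2 + Y) * ((m + 6 * t) ^ 2 + Y))) := by
    have h4 : (m + 4 * t) ^ 2 + Y ≠ 0 := by positivity
    have h5 : (m + 5 * t) ^ 2 + Y ≠ 0 := by positivity
    have h6 : (m + 6 * t) ^ 2 + Y ≠ 0 := by positivity
    field_simp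
  rw [hN 49 (by norm_num), hN 50 (by norm_num), mul_div_assoc', mul_div_assoc',
    div_le_div_iff₀ (by positivity) (by positivity), ← sub_nonneg]
  ring_nf
  positivity

/-- The alternating sum of triple kernels, symmetrised under `z ↦ 1 - z`. -/
noncomputable def alternatingKernel (t : ℝ) (z : ℂ) : ℂ :=
  ∑ k ∈ Finset.range 50, (alternatingWeight k : ℂ) *
    (tripleKernel (t : ℂ) (k + 1 - z) + tripleKernel (t : ℂ) (k + z))

lemma re_alternatingKernel_nonneg_of_re_eq_zero {t : ℝ} (ht : 0 < t) {z : ℂ} (hz : z.re = 0) :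
    0 ≤ (alternatingKernel t z).re := by
  have hz' : z = z.im * I := by apply Complex.ext <;> simp [hz]
  have h1 (k : ℕ) : (tripleKernel (t : ℂ) (k + 1 - z)).re =
      (tripleKernel (t : ℂ) ((k + 1 : ℕ) + z.im * I)).re := by
    rw [re_tripleKernel, re_tripleKernel]
    simp [hz]
  have h := sum_alternatingWeight_mul_add_succ fun k ↦ (tripleKernel (t : ℂ) (k + z.im * I)).re
  have h2 : (alternatingKernel t z).re = ∑ k ∈ Finset.range 50, alternatingWeight k *
      ((tripleKernel (t : ℂ) ((k + 1 : ℕ) + z.im * I)).re +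
        (tripleKernel (t : ℂ) (k + z.im * I)).re) := by
    rw [alternatingKernel, re_sum]
    refine Finset.sum_congr rfl fun k _ ↦ ?_
    rw [re_ofReal_mul, add_re, h1, ← hz']
  rw [h2, h]
  have h3 := re_tripleKernel_fifty_le (y := z.im) ht
  have h4 := re_tripleKernel_nonneg_of_re_eq_zero ht hz
  rw [hz'] at h4
  simp only [Nat.cast_zero, zero_add, Nat.cast_ofNat]
  linarith

lemma alternatingKernel_one_sub (t : ℝ) (z : ℂ) :
    alternatingKernel t (1 - z) = alternatingKernel t z := by
  refine Finset.sum_congr rfl fun k _ ↦ ?_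
  rw [add_comm, show (k : ℂ) + (1 - z) = k + 1 - z by ring,
    show (k : ℂ) + 1 - (1 - z) = k + z by ring]

lemma norm_tripleKernel_le {t : ℝ} (ht : 0 < t) {z : ℂ} (hz : 0 ≤ z.re) :
    ‖tripleKernel (t : ℂ) z‖ ≤ 33 / t := by
  have h (j : ℝ) (hj : 1 ≤ j) : ‖1 / (z + (j : ℂ) * t)‖ ≤ 1 / t := by
    rw [norm_div, norm_one]
    refine one_div_le_one_div_of_le ht ?_
    refine le_trans ?_ (re_le_norm _)
    simp
    nlinarith
  have h4 := h 4 (by norm_num)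
  have h5 := h 5 (by norm_num)
  have h6 := h 6 (by norm_num)
  push_cast at h4 h5 h6
  refine (norm_add_le _ _).trans ((add_le_add (norm_sub_le _ _) le_rfl).trans ?_)
  simp only [norm_mul, RCLike.norm_ofNat]
  rw [show 33 / t = 11 * (1 / t) + 16 * (1 / t) + 6 * (1 / t) by ring]
  gcongr

lemma differentiableAt_tripleKernel {t : ℝ} (ht : 0 < t) {z : ℂ} (hz : 0 ≤ z.re) :
    DifferentiableAt ℂ (tripleKernel (t : ℂ)) z := by
  have h (j : ℝ) (hj : 0 < j) : z + (j : ℂ) * t ≠ 0 := by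
    intro h0
    have := congrArg re h0
    simp at this
    nlinarith [mul_pos hj ht]
  have h4 := h 4 (by norm_num)
  have h5 := h 5 (by norm_num)
  have h6 := h 6 (by norm_num)
  push_cast at h4 h5 h6
  unfold tripleKernel
  fun_prop (disch := assumption)

lemma re_alternatingKernel_nonneg {t : ℝ} (ht : 0 < t) {z : ℂ} (hz0 : 0 ≤ z.re) (hz1 : z.re ≤ 1) :
    0 ≤ (alternatingKernel t z).re := by
  have hd : ∀ w : ℂ, 0 ≤ w.re → w.re ≤ 1 → DifferentiableAt ℂ (alternatingKernel t) w := by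
    intro w h0 h1
    unfold alternatingKernel
    refine DifferentiableAt.fun_sum fun k _ ↦ ?_
    have hk : (0 : ℝ) ≤ k := k.cast_nonneg
    have d1 := differentiableAt_tripleKernel ht (z := k + 1 - w) (by simp; linarith)
    have d2 := differentiableAt_tripleKernel ht (z := k + w) (by simp; linarith)
    have e1 : DifferentiableAt ℂ (fun w : ℂ ↦ (k : ℂ) + 1 - w) w := by fun_prop
    have e2 : DifferentiableAt ℂ (fun w : ℂ ↦ (k : ℂ) + w) w := by fun_prop
    exact ((d1.comp w e1).add (d2.comp w e2)).const_mul _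
  have hb : ∀ w : ℂ, 0 ≤ w.re → w.re ≤ 1 → ‖alternatingKernel t w‖ ≤
      ∑ k ∈ Finset.range 50, ‖(alternatingWeight k : ℂ)‖ * (33 / t + 33 / t) := by
    intro w h0 h1
    refine norm_sum_le_of_le _ fun k _ ↦ ?_
    rw [norm_mul]
    have hk : (0 : ℝ) ≤ k := k.cast_nonneg
    gcongr
    exact (norm_add_le _ _).trans (add_le_add (norm_tripleKernel_le ht (by simp; linarith))
      (norm_tripleKernel_le ht (by simp; linarith)))
  set C := ∑ k ∈ Finset.range 50, ‖(alternatingWeight k : ℂ)‖ * (33 / t + 33 / t)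
  have hexp : ‖Complex.exp (-alternatingKernel t z)‖ ≤ 1 := by
    refine PhragmenLindelof.vertical_strip (a := 0) (b := 1)
      (f := fun z ↦ Complex.exp (-alternatingKernel t z)) ?_ ?_ ?_ ?_ hz0 hz1
    · have hcl : closure (re ⁻¹' Set.Ioo (0 : ℝ) 1) = re ⁻¹' Set.Icc (0 : ℝ) 1 := by
        rw [closure_preimage_re, closure_Ioo zero_ne_one]
      refine DifferentiableOn.diffContOnCl fun w hw ↦ ?_
      rw [hcl] at hw
      exact (hd w hw.1 hw.2).neg.cexp.differentiableWithinAt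
    · refine ⟨0, by simpa using Real.pi_pos, 0, ?_⟩
      refine Asymptotics.IsBigO.of_bound (Real.exp C) ?_
      refine Filter.eventually_inf_principal.mpr (Filter.Eventually.of_forall fun w hw ↦ ?_)
      rw [norm_exp]
      simp only [zero_mul, Real.exp_zero, norm_one, mul_one]
      refine Real.exp_le_exp.mpr ((re_le_norm _).trans ?_)
      rw [norm_neg]
      exact hb w hw.1.le hw.2.le
    · intro w hw
      rw [norm_exp, Real.exp_le_one_iff, neg_re]
      exact neg_nonpos.mpr (re_alternatingKernel_nonneg_of_re_eq_zero ht hw)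
    · intro w hw
      rw [norm_exp, Real.exp_le_one_iff, neg_re, ← alternatingKernel_one_sub]
      exact neg_nonpos.mpr (re_alternatingKernel_nonneg_of_re_eq_zero ht (by simp [hw]))
  rw [norm_exp, Real.exp_le_one_iff, neg_re] at hexp
  linarith

/-- The weights of the detector used to separate two real zeros. -/
noncomputable def detectorWeight (i : ℕ × Fin 3) : ℝ := alternatingWeight i.1 * ![11, -16, 6] i.2

/-- The points at which the detector used to separate two real zeros is evaluated. -/
noncomputable def detectorPoint (t : ℝ) (i : ℕ × Fin 3) : ℝ := 1 + ![4, 5, 6] i.2 * t + i.1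

/-- The index set of the detector used to separate two real zeros. -/
def detectorIndex : Finset (ℕ × Fin 3) := Finset.range 50 ×ˢ Finset.univ

lemma sum_detectorWeight_mul (f : ℕ × Fin 3 → ℝ) :
    ∑ i ∈ detectorIndex, detectorWeight i * f i = ∑ k ∈ Finset.range 50,
      alternatingWeight k * (11 * f (k, 0) - 16 * f (k, 1) + 6 * f (k, 2)) := by
  rw [detectorIndex, Finset.sum_product]
  refine Finset.sum_congr rfl fun k _ ↦ ?_
  simp [Fin.sum_univ_three, detectorWeight]
  ring

lemma sum_detectorWeight : ∑ i ∈ detectorIndex, detectorWeight i = 50 / 99 := by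
  have h := sum_detectorWeight_mul fun _ ↦ 1
  simp only [mul_one] at h
  rw [h, ← sum_alternatingWeight]
  norm_num

lemma zeroKernel_detector (t : ℝ) (ρ : ℂ) :
    zeroKernel detectorIndex detectorWeight (detectorPoint t) ρ = alternatingKernel t ρ := by
  rw [zeroKernel, detectorIndex, Finset.sum_product]
  refine Finset.sum_congr rfl fun k _ ↦ ?_
  simp only [Fin.sum_univ_three, detectorWeight, detectorPoint, tripleKernel]
  simp only [Matrix.cons_val]
  push_cast
  rw [show (1 : ℂ) + 4 * t + k - ρ = k + 1 - ρ + 4 * t by ring,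
    show (1 : ℂ) + 5 * t + k - ρ = k + 1 - ρ + 5 * t by ring,
    show (1 : ℂ) + 6 * t + k - ρ = k + 1 - ρ + 6 * t by ring,
    show (1 : ℂ) + 4 * t + k - 1 + ρ = k + ρ + 4 * t by ring,
    show (1 : ℂ) + 5 * t + k - 1 + ρ = k + ρ + 5 * t by ring,
    show (1 : ℂ) + 6 * t + k - 1 + ρ = k + ρ + 6 * t by ring]
  ring

lemma one_lt_detectorPoint {t : ℝ} (ht : 0 < t) (i : ℕ × Fin 3) : 1 < detectorPoint t i := by
  obtain ⟨k, j⟩ := i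
  have hk : (0 : ℝ) ≤ k := k.cast_nonneg
  fin_cases j <;> simp [detectorPoint] <;> linarith

lemma sum_detectorWeight_mul_rpow_nonneg (t : ℝ) {n : ℕ} (hn : n ≠ 0) :
    0 ≤ ∑ i ∈ detectorIndex, detectorWeight i * (n : ℝ) ^ (-detectorPoint t i) := by
  have hn0 : (0 : ℝ) < n := by exact_mod_cast Nat.pos_of_ne_zero hn
  have hn1 : (1 : ℝ) ≤ n := by exact_mod_cast Nat.one_le_iff_ne_zero.mpr hn
  set X : ℝ := (n : ℝ) ^ (-t) with hX
  have hpow (j k : ℕ) : (n : ℝ) ^ (-(1 + j * t + k)) = (n : ℝ)⁻¹ * X ^ j * (n : ℝ)⁻¹ ^ k := by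
    rw [show -(1 + j * t + k) = -1 + (-t) * j + -(k : ℝ) by ring, Real.rpow_add hn0,
      Real.rpow_add hn0, Real.rpow_mul_natCast hn0.le, Real.rpow_neg_one,
      Real.rpow_neg hn0.le k, Real.rpow_natCast, inv_pow]
  rw [sum_detectorWeight_mul]
  have h : ∑ k ∈ Finset.range 50, alternatingWeight k *
      (11 * (n : ℝ) ^ (-detectorPoint t (k, 0)) - 16 * (n : ℝ) ^ (-detectorPoint t (k, 1)) +
        6 * (n : ℝ) ^ (-detectorPoint t (k, 2))) =
      ((n : ℝ)⁻¹ * X ^ 4 * (11 - 16 * X + 6 * X ^ 2)) *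
        ∑ k ∈ Finset.range 50, alternatingWeight k * (n : ℝ)⁻¹ ^ k := by
    rw [Finset.mul_sum]
    refine Finset.sum_congr rfl fun k _ ↦ ?_
    have h4 := hpow 4 k
    have h5 := hpow 5 k
    have h6 := hpow 6 k
    simp only [Nat.cast_ofNat] at h4 h5 h6
    simp only [detectorPoint, Matrix.cons_val, h4, h5, h6]
    ring
  rw [h]
  refine mul_nonneg (mul_nonneg (by positivity) (by nlinarith [sq_nonneg (3 * X - 4)])) ?_
  exact sum_alternatingWeight_mul_pow_nonneg (by positivity) (inv_le_one_of_one_le₀ hn1)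

lemma sum_detectorWeight_mul_re_digamma_le {t b : ℝ} (ht : 0 < t) (hb : 0 ≤ b) :
    ∑ i ∈ detectorIndex, detectorWeight i * (digamma (((detectorPoint t i + b) / 2 : ℝ) : ℂ)).re ≤
      1 / 2 * Real.log ((1 + b + 4 * t) / 2) + 1 / 198 * Real.log ((50 + b + 4 * t) / 2) := by
  have h := sum_mul_re_digamma_le detectorIndex (Finset.univ : Finset (Fin 2)) detectorWeight
    (fun i ↦ (detectorPoint t i + b) / 2) ![1 / 2, 1 / 198]
    ![(1 + b + 4 * t) / 2, (50 + b + 4 * t) / 2]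
    (fun i _ ↦ by have := one_lt_detectorPoint ht i; positivity)
    (fun i _ ↦ by fin_cases i <;> simp <;> positivity)
    (by rw [sum_detectorWeight]; simp; norm_num)
    (fun n ↦ by
      have hn : (0 : ℝ) ≤ n := n.cast_nonneg
      have hu : 0 ≤ 1 + b + 2 * n := by positivity
      have := sum_alternatingWeight_mul_tripleKernel_ge ht hu
      rw [sum_detectorWeight_mul]
      have heq : ∑ k ∈ Finset.range 50, alternatingWeight k *
          (11 * (1 / ((detectorPoint t (k, 0) + b) / 2 + n)) -
            16 * (1 / ((detectorPoint t (k, 1) + b) / 2 + n)) +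
            6 * (1 / ((detectorPoint t (k, 2) + b) / 2 + n))) =
          2 * ∑ k ∈ Finset.range 50, alternatingWeight k * tripleKernel t (1 + b + 2 * n + k) := by
        rw [Finset.mul_sum]
        refine Finset.sum_congr rfl fun k _ ↦ ?_
        have hk : (0 : ℝ) ≤ k := k.cast_nonneg
        have hj (j : ℝ) : 1 / ((1 + j * t + k + b) / 2 + n) =
            2 * (1 / (1 + b + 2 * n + k + j * t)) := by
          rw [show (1 + j * t + k + b) / 2 + n = (1 + b + 2 * n + k + j * t) / 2 by ring,
            one_div_div]
          ring
        simp only [detectorPoint, Matrix.cons_val, hj, tripleKernel]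
        ring
      rw [heq]
      simp only [Fin.sum_univ_two, Matrix.cons_val]
      rw [show (1 + b + 4 * t) / 2 + n = (1 + b + 2 * n + 4 * t) / 2 by ring,
        show (50 + b + 4 * t) / 2 + n = (1 + b + 2 * n + 49 + 4 * t) / 2 by ring, one_div_div,
        one_div_div]
      rw [show ∀ y : ℝ, 2 / y = 2 * (1 / y) by intro y; ring]
      rw [show ∀ y : ℝ, 2 / y = 2 * (1 / y) by intro y; ring]
      linarith)
  refine h.trans ?_
  simp only [Fin.sum_univ_two, Matrix.cons_val]
  gcongr
  · exact re_digamma_le_log (by positivity)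
  · exact re_digamma_le_log (by positivity)

lemma re_alternatingKernel_ofReal (t x : ℝ) :
    (alternatingKernel t x).re = ∑ k ∈ Finset.range 50, alternatingWeight k *
      (tripleKernel t (k + 1 - x) + tripleKernel t (k + x)) := by
  rw [alternatingKernel, re_sum]
  refine Finset.sum_congr rfl fun k _ ↦ ?_
  rw [re_ofReal_mul, ← ofReal_re (tripleKernel t (k + 1 - x) + tripleKernel t (k + x)), ofReal_add,
    ofReal_tripleKernel, ofReal_tripleKernel]
  push_cast
  rfl

lemma re_alternatingKernel_ofReal_ge {t β : ℝ} (ht : 0 < t) (hβ0 : 1 - t ≤ β) (hβ1 : β ≤ 1)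
    (hβ : 1 / 2 ≤ β) : 41 / 105 / t ≤ (alternatingKernel t β).re := by
  have h := tripleKernel_le_sum_alternatingWeight_mul ht (x := 1 - β) (by linarith) (by linarith)
  have h1 := (isDecreasingConvex_tripleKernel ht).anti (1 - β) (t - (1 - β)) (by linarith)
    (by linarith)
  have h2 : tripleKernel t (1 - β + (t - (1 - β))) = 41 / 105 / t := by
    unfold tripleKernel
    rw [show 1 - β + (t - (1 - β)) = t by ring]
    field_simp
    norm_num
  rw [← alternatingKernel_one_sub, ← ofReal_one, ← ofReal_sub, re_alternatingKernel_ofReal]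
  linarith

lemma re_alternatingKernel_zero_le {t : ℝ} (ht : 0 < t) :
    (alternatingKernel t 0).re ≤ 11 / 20 / t + 50 / 99 * (1 / 49) := by
  have h := sum_alternatingWeight_mul_tripleKernel_le ht
  have h2 : tripleKernel t 0 = 11 / 20 / t := by
    unfold tripleKernel
    field_simp
    ring
  have h3 := re_alternatingKernel_ofReal t 0
  simp only [sub_zero, add_zero, ofReal_zero] at h3
  rw [h3, ← h2]
  exact h

namespace DirichletCharacter

variable {q : ℕ} [NeZero q] {χ : DirichletCharacter ℂ q}

lemma xiProduct_one_sub_eq_zero (hprim : χ.IsPrimitive) (hinv : χ⁻¹ = χ) {s : ℂ}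
    (h : χ.xiProduct s = 0) : χ.xiProduct (1 - s) = 0 := by
  rw [xiProduct_one_sub hprim hinv, h, mul_zero]

lemma lt_one_of_LFunction_eq_zero (hχ : χ ≠ 1) {β : ℝ} (h : LFunction χ β = 0) : β < 1 := by
  by_contra! hβ
  exact LFunction_ne_zero_of_one_le_re χ (.inl hχ) (by simpa using hβ) h

lemma log_le_of_LFunction_eq_zero (hχ : χ ≠ 1) (hprim : χ.IsPrimitive) (hinv : χ⁻¹ = χ) {t : ℝ}
    (ht : 0 < t) (ht2 : t < 1 / 2) {β₁ β₂ : ℝ} (hβ : β₁ ≠ β₂) (h₁ : LFunction χ β₁ = 0)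
    (h₂ : LFunction χ β₂ = 0) (hβ₁ : 1 - t ≤ β₁) (hβ₂ : 1 - t ≤ β₂) :
    97 / 420 / t < 25 / 99 * Real.log q := by
  have hlt₁ := lt_one_of_LFunction_eq_zero hχ h₁
  have hlt₂ := lt_one_of_LFunction_eq_zero hχ h₂
  have hx₁ := xiProduct_eq_zero_of_LFunction_eq_zero (s := (β₁ : ℂ)) (by simp; linarith) h₁
  have hx₂ := xiProduct_eq_zero_of_LFunction_eq_zero (s := (β₂ : ℂ)) (by simp; linarith) h₂
  obtain ⟨a, ha0, ha1, ha⟩ := exists_gammaFactor_eq χ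
  have h := half_sum_re_zeroKernel_le_archimedean hχ hprim hinv ha0 ha detectorIndex detectorWeight
    (detectorPoint t) (fun i _ ↦ one_lt_detectorPoint ht i)
    (fun ρ h0 h1 ↦ by
      rw [zeroKernel_detector]
      exact re_alternatingKernel_nonneg ht h0 h1)
    (fun n hn ↦ sum_detectorWeight_mul_rpow_nonneg t hn)
    (({β₁, 1 - β₁, β₂, 1 - β₂} : Finset ℝ).map ⟨((↑) : ℝ → ℂ), ofReal_injective⟩)
    (fun ρ hρ ↦ by
      simp only [Finset.mem_map, Finset.mem_insert, Finset.mem_singleton,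
        Function.Embedding.coeFn_mk] at hρ
      obtain ⟨x, rfl | rfl | rfl | rfl, rfl⟩ := hρ
      · exact hx₁
      · simpa using xiProduct_one_sub_eq_zero hprim hinv hx₁
      · exact hx₂
      · simpa using xiProduct_one_sub_eq_zero hprim hinv hx₂)
  have n1 : β₁ ∉ ({1 - β₁, β₂, 1 - β₂} : Finset ℝ) := by
    simp only [Finset.mem_insert, Finset.mem_singleton, not_or]
    exact ⟨fun h ↦ by linarith, hβ, fun h ↦ by linarith⟩
  have n2 : 1 - β₁ ∉ ({β₂, 1 - β₂} : Finset ℝ) := by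
    simp only [Finset.mem_insert, Finset.mem_singleton, not_or]
    exact ⟨fun h ↦ by linarith, fun h ↦ hβ (by linarith)⟩
  have n3 : β₂ ∉ ({1 - β₂} : Finset ℝ) := by
    simp only [Finset.mem_singleton]
    exact fun h ↦ by linarith
  rw [Finset.sum_map, Finset.sum_insert n1, Finset.sum_insert n2, Finset.sum_insert n3,
    Finset.sum_singleton] at h
  simp only [Function.Embedding.coeFn_mk, zeroKernel_detector, ofReal_sub, ofReal_one,
    alternatingKernel_one_sub, sum_detectorWeight] at h
  have k₁ := re_alternatingKernel_ofReal_ge ht hβ₁ hlt₁.le (by linarith)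
  have k₂ := re_alternatingKernel_ofReal_ge ht hβ₂ hlt₂.le (by linarith)
  have k0 := re_alternatingKernel_zero_le ht
  have d0 := sum_detectorWeight_mul_re_digamma_le ht le_rfl
  have da := sum_detectorWeight_mul_re_digamma_le ht ha0
  simp only [add_zero] at d0
  have l0 : Real.log ((1 + 4 * t) / 2) ≤ 1 / 2 :=
    (Real.log_le_sub_one_of_pos (by positivity)).trans (by linarith)
  have la : Real.log ((1 + a + 4 * t) / 2) ≤ Real.log 2 :=
    Real.log_le_log (by positivity) (by linarith)
  have l5 : ∀ x : ℝ, 0 < x → x ≤ 32 → Real.log x ≤ 5 * Real.log 2 := by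
    intro x hx hx2
    rw [← Real.log_rpow (by norm_num)]
    exact Real.log_le_log hx (by norm_num; exact hx2)
  have l50 := l5 ((50 + 4 * t) / 2) (by positivity) (by linarith)
  have l5a := l5 ((50 + a + 4 * t) / 2) (by positivity) (by linarith)
  have l2 := Real.log_two_lt_d9
  have lπ : 1 ≤ Real.log π := by
    rw [Real.le_log_iff_exp_le Real.pi_pos]
    linarith [Real.exp_one_lt_d9, Real.pi_gt_three]
  have e1 : 97 / 420 / t = 2 * (41 / 105 / t) - 11 / 20 / t := by ring
  rw [e1]
  linarith

end DirichletCharacter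

lemma Real.log_three_gt : 1.095 < Real.log 3 := by
  have h : Real.log (9 / 8) = 2 * Real.log 3 - 3 * Real.log 2 := by
    rw [Real.log_div (by norm_num) (by norm_num), show (9 : ℝ) = 3 ^ 2 by norm_num,
      show (8 : ℝ) = 2 ^ 3 by norm_num, Real.log_pow, Real.log_pow]
    norm_num
  have := Real.one_sub_inv_le_log_of_pos (x := 9 / 8) (by norm_num)
  linarith [Real.log_two_gt_d9]

lemma Real.log_three_lt : Real.log 3 < 1.1023 := by
  have h : Real.log (9 / 8) = 2 * Real.log 3 - 3 * Real.log 2 := by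
    rw [Real.log_div (by norm_num) (by norm_num), show (9 : ℝ) = 3 ^ 2 by norm_num,
      show (8 : ℝ) = 2 ^ 3 by norm_num, Real.log_pow, Real.log_pow]
    norm_num
  have := Real.log_le_sub_one_of_pos (x := 9 / 8) (by norm_num)
  linarith [Real.log_two_lt_d9]

lemma Real.log_seven_gt : 1.93 < Real.log 7 := by
  have h : Real.log (7 / 8) = Real.log 7 - 3 * Real.log 2 := by
    rw [Real.log_div (by norm_num) (by norm_num), show (8 : ℝ) = 2 ^ 3 by norm_num, Real.log_pow]
    norm_num
  have := Real.one_sub_inv_le_log_of_pos (x := 7 / 8) (by norm_num)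
  linarith [Real.log_two_gt_d9]

namespace DirichletCharacter

variable {q : ℕ} [NeZero q] {χ : DirichletCharacter ℂ q}

lemma eq_half_of_LFunction_eq_zero_of_le_six (hq : q ≤ 6) (hχ : χ ≠ 1) (hprim : χ.IsPrimitive)
    (hinv : χ⁻¹ = χ) {β : ℝ} (hβ : 0 < β) (h : LFunction χ β = 0) : β = 1 / 2 := by
  by_contra hne
  have hlt := lt_one_of_LFunction_eq_zero hχ h
  have hx := xiProduct_eq_zero_of_LFunction_eq_zero (s := (β : ℂ)) (by simpa using hβ) h
  obtain ⟨a, ha0, ha1, ha⟩ := exists_gammaFactor_eq χ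
  have hker (ρ : ℂ) : zeroKernel {()} (fun _ ↦ 1) (fun _ ↦ 2) ρ = 1 / (2 - ρ) + 1 / (1 + ρ) := by
    simp only [zeroKernel, Finset.sum_singleton]
    push_cast
    ring
  have hker_re (x : ℝ) : (zeroKernel {()} (fun _ ↦ 1) (fun _ ↦ 2) x).re =
      1 / (2 - x) + 1 / (1 + x) := by
    rw [hker]
    norm_cast
  have hle := half_sum_re_zeroKernel_le_archimedean hχ hprim hinv ha0 ha {()} (fun _ ↦ 1)
    (fun _ ↦ 2) (fun _ _ ↦ by norm_num)
    (fun ρ h0 h1 ↦ by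
      rw [hker, add_re, re_one_div, re_one_div]
      simp only [sub_re, add_re, re_ofNat, one_re]
      exact add_nonneg (div_nonneg (by linarith) (by positivity))
        (div_nonneg (by linarith) (by positivity)))
    (fun n _ ↦ by
      simp only [Finset.sum_singleton, one_mul]
      positivity)
    (({β, 1 - β} : Finset ℝ).map ⟨((↑) : ℝ → ℂ), ofReal_injective⟩)
    (fun ρ hρ ↦ by
      simp only [Finset.mem_map, Finset.mem_insert, Finset.mem_singleton,
        Function.Embedding.coeFn_mk] at hρ
      obtain ⟨x, rfl | rfl, rfl⟩ := hρ
      · exact hx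
      · simpa using xiProduct_one_sub_eq_zero hprim hinv hx)
  have hn : β ∉ ({1 - β} : Finset ℝ) := by
    simp only [Finset.mem_singleton]
    exact fun h ↦ hne (by linarith)
  have h0 := hker_re 0
  rw [ofReal_zero] at h0
  rw [Finset.sum_map, Finset.sum_insert hn, Finset.sum_singleton] at hle
  simp only [Function.Embedding.coeFn_mk, hker_re, h0, Finset.sum_singleton, one_mul] at hle
  have hsum : 4 / 3 ≤ 1 / (2 - β) + 1 / (1 + β) := by
    rw [div_add_div _ _ (by linarith) (by linarith), div_le_div_iff₀ (by norm_num) (by nlinarith)]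
    nlinarith [sq_nonneg (2 * β - 1)]
  have hsymm : 1 / (2 - (1 - β)) + 1 / (1 + (1 - β)) = 1 / (2 - β) + 1 / (1 + β) := by ring
  have hγ := Real.one_half_lt_eulerMascheroniConstant
  have hψ : (digamma ((2 / 2 : ℝ) : ℂ)).re ≤ -(1 / 2) := by
    norm_num [digamma_one]
    linarith
  have hψa : (digamma (((2 + a) / 2 : ℝ) : ℂ)).re ≤ Real.log 3 - Real.log 2 := by
    rw [← Real.log_div (by norm_num) (by norm_num)]
    exact (re_digamma_le_log (by linarith)).trans (Real.log_le_log (by linarith) (by linarith))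
  have hlogq : Real.log q ≤ Real.log 2 + Real.log 3 := by
    rw [← Real.log_mul (by norm_num) (by norm_num)]
    refine Real.log_le_log (by exact_mod_cast NeZero.pos q) ?_
    norm_num
    exact_mod_cast hq
  have hlogπ : Real.log 3 ≤ Real.log π := Real.log_le_log (by norm_num) Real.pi_gt_three.le
  rw [hsymm] at hle
  linarith [Real.log_three_lt, Real.log_two_lt_d9]

end DirichletCharacter

/-- **Theorem 2 (Kadiri).** If `χ` is a real non-principal primitive Dirichlet character
modulo `q ≥ 3` and `β₁ ≠ β₂` are two real zeros of `L(s,χ)`, then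
`min β₁ β₂ ≤ 1 - 1/(1.0971 * log q)`. -/
theorem real_zeros_repulsion_one_character (q : ℕ) (hq : 3 ≤ q)
    (χ : DirichletCharacter ℂ q)
    (hχ_nonprincipal : χ ≠ 1)
    (hχ_real : ∀ n : ZMod q, (χ n).im = 0)
    (hχ_primitive : χ.conductor = q)
    (β₁ β₂ : ℝ) (hβ : β₁ ≠ β₂) :
    letI : NeZero q := ⟨by omega⟩
    DirichletCharacter.LFunction χ β₁ = 0 →
    DirichletCharacter.LFunction χ β₂ = 0 →
    min β₁ β₂ ≤ 1 - 1 / (1.0971 * Real.log q) := by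
  have : NeZero q := ⟨by omega⟩
  intro h₁ h₂
  have hprim : χ.IsPrimitive := (DirichletCharacter.isPrimitive_def χ).mpr hχ_primitive
  have hinv := DirichletCharacter.inv_eq_self_of_real hχ_real
  have hlog : 1.095 < Real.log q :=
    Real.log_three_gt.trans_le (Real.log_le_log (by norm_num) (by exact_mod_cast hq))
  by_contra! hmin
  set t := 1 / (1.0971 * Real.log q) with ht_def
  have ht : 0 < t := by positivity
  have ht1 : t < 1 := by
    rw [ht_def, div_lt_one (by positivity)]
    linarith
  obtain ⟨hβ₁, hβ₂⟩ := lt_min_iff.mp hmin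
  rcases le_or_gt q 6 with hq6 | hq7
  · exact hβ ((DirichletCharacter.eq_half_of_LFunction_eq_zero_of_le_six hq6 hχ_nonprincipal hprim
      hinv (by linarith) h₁).trans (DirichletCharacter.eq_half_of_LFunction_eq_zero_of_le_six hq6
      hχ_nonprincipal hprim hinv (by linarith) h₂).symm)
  · have hlog7 : 1.93 < Real.log q :=
      Real.log_seven_gt.trans_le (Real.log_le_log (by norm_num) (by exact_mod_cast hq7))
    have ht2 : t < 1 / 2 := by
      rw [ht_def, div_lt_div_iff₀ (by positivity) (by norm_num)]
      linarith
    have h := DirichletCharacter.log_le_of_LFunction_eq_zero hχ_nonprincipal hprim hinv ht ht2 hβ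
      h₁ h₂ hβ₁.le hβ₂.le
    rw [ht_def, div_div_eq_mul_div, div_one] at h
    linarith
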